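/- arXiv:1204.2909 — 4 statements merged into one kernel-verified Lean document; each statement's English description precedes it below -/
import Mathlib

section
/- Let q ≥ 1 and let A be a real q×q matrix that is Metzler (all off-diagonal entries nonnegative) and irreducible, and suppose h_eq ∈ ℝ^q is a nonzero vector with all components nonnegative satisfying A h_eq = 0. Then 0 is an eigenvalue of A of algebraic multiplicity 1 (a simple root of the characteristic polynomial of A over ℂ), and every other complex eigenvalue of A has strictly negative real part. -/
theorem aux_min {q : ℕ} (A : Matrix (Fin q) (Fin q) ℝ)
    (hM : ∀ i j : Fin q, i ≠ j → 0 ≤ A i j)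
    (hI : ∀ S : Set (Fin q), S.Nonempty → S ≠ Set.univ →
      ∃ i ∈ S, ∃ j, j ∉ S ∧ A i j ≠ 0)
    (u : Fin q → ℝ) (hu : ∀ i, 0 ≤ u i) (hAu : ∀ i, A.mulVec u i ≤ 0)
    (i₀ : Fin q) (h0 : u i₀ = 0) : u = 0 := by
  by_contra hne
  obtain ⟨i, hi, j, hj, hij⟩ := hI {i | u i = 0} ⟨i₀, h0⟩ (by
    intro h
    apply hne
    funext k
    have : k ∈ {i | u i = 0} := by rw [h]; trivial
    exact this)
  simp only [Set.mem_setOf_eq] at hi hj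
  have hne' : i ≠ j := by rintro rfl; exact hj hi
  have h1 : A i j * u j ≤ ∑ k, A i k * u k := by
    apply Finset.single_le_sum (f := fun k => A i k * u k) _ (Finset.mem_univ j)
    intro k _
    by_cases hk : i = k
    · subst hk; simp [hi]
    · exact mul_nonneg (hM i k hk) (hu k)
  have h2 : 0 < A i j * u j :=
    mul_pos (lt_of_le_of_ne (hM i j hne') (Ne.symm hij)) (lt_of_le_of_ne (hu j) (Ne.symm hj))
  have h3 := hAu i
  simp only [Matrix.mulVec, dotProduct] at h3
  linarith

theorem aux_pos {q : ℕ} (A : Matrix (Fin q) (Fin q) ℝ)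
    (hM : ∀ i j : Fin q, i ≠ j → 0 ≤ A i j)
    (hI : ∀ S : Set (Fin q), S.Nonempty → S ≠ Set.univ →
      ∃ i ∈ S, ∃ j, j ∉ S ∧ A i j ≠ 0)
    (h : Fin q → ℝ) (hne : h ≠ 0) (hnn : ∀ i, 0 ≤ h i)
    (hnull : A.mulVec h = 0) (i : Fin q) : 0 < h i := by
  refine lt_of_le_of_ne (hnn i) (fun hi => hne ?_)
  exact aux_min A hM hI h hnn (fun k => by simp [hnull]) i hi.symm

theorem aux_max {q : ℕ} (hq : 1 ≤ q) (A : Matrix (Fin q) (Fin q) ℝ)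
    (hM : ∀ i j : Fin q, i ≠ j → 0 ≤ A i j)
    (hI : ∀ S : Set (Fin q), S.Nonempty → S ≠ Set.univ →
      ∃ i ∈ S, ∃ j, j ∉ S ∧ A i j ≠ 0)
    (h : Fin q → ℝ) (hpos : ∀ i, 0 < h i) (hnull : A.mulVec h = 0)
    (v : Fin q → ℝ) (hv : ∀ i, 0 ≤ A.mulVec v i) : ∃ c : ℝ, v = c • h := by
  haveI : Nonempty (Fin q) := ⟨⟨0, hq⟩⟩
  obtain ⟨i₀, hi₀⟩ := Finite.exists_max (fun i => v i / h i)
  refine ⟨v i₀ / h i₀, ?_⟩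
  have key : (v i₀ / h i₀) • h - v = 0 := by
    apply aux_min A hM hI _ _ _ i₀
    · have := (hpos i₀).ne'
      simp [this]
    · intro i
      have := hi₀ i
      simp only [Pi.sub_apply, Pi.smul_apply, smul_eq_mul]
      rw [div_le_iff₀ (hpos i)] at this
      linarith
    · intro i
      rw [Matrix.mulVec_sub, Matrix.mulVec_smul, hnull]
      simpa using hv i
  exact (sub_eq_zero.mp key).symm

theorem aux_max' {q : ℕ} (hq : 1 ≤ q) (A : Matrix (Fin q) (Fin q) ℝ)
    (hM : ∀ i j : Fin q, i ≠ j → 0 ≤ A i j)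
    (hI : ∀ S : Set (Fin q), S.Nonempty → S ≠ Set.univ →
      ∃ i ∈ S, ∃ j, j ∉ S ∧ A i j ≠ 0)
    (h : Fin q → ℝ) (hpos : ∀ i, 0 < h i) (hnull : A.mulVec h = 0)
    (v : Fin q → ℝ) (a : ℝ) (hv : A.mulVec v = a • h) : ∃ c : ℝ, v = c • h := by
  rcases le_total 0 a with ha | ha
  · apply aux_max hq A hM hI h hpos hnull
    intro i
    rw [hv]
    exact mul_nonneg ha (hpos i).le
  · obtain ⟨c, hc⟩ := aux_max hq A hM hI h hpos hnull (-v) (by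
      intro i
      rw [Matrix.mulVec_neg, hv]
      have := mul_nonneg (neg_nonneg.mpr ha) (hpos i).le
      simpa using this)
    exact ⟨-c, by rw [neg_smul, ← hc, neg_neg]⟩

theorem aux_re {q : ℕ} (A : Matrix (Fin q) (Fin q) ℝ) (v : Fin q → ℂ) (i : Fin q) :
    ((A.map Complex.ofReal).mulVec v i).re = A.mulVec (fun j => (v j).re) i := by
  simp [Matrix.mulVec, dotProduct]

theorem aux_im {q : ℕ} (A : Matrix (Fin q) (Fin q) ℝ) (v : Fin q → ℂ) (i : Fin q) :
    ((A.map Complex.ofReal).mulVec v i).im = A.mulVec (fun j => (v j).im) i := by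
  simp [Matrix.mulVec, dotProduct]

theorem aux_cplx {q : ℕ} (hq : 1 ≤ q) (A : Matrix (Fin q) (Fin q) ℝ)
    (hM : ∀ i j : Fin q, i ≠ j → 0 ≤ A i j)
    (hI : ∀ S : Set (Fin q), S.Nonempty → S ≠ Set.univ →
      ∃ i ∈ S, ∃ j, j ∉ S ∧ A i j ≠ 0)
    (h : Fin q → ℝ) (hpos : ∀ i, 0 < h i) (hnull : A.mulVec h = 0)
    (v : Fin q → ℂ) (a : ℂ)
    (hv : (A.map Complex.ofReal).mulVec v = a • (fun i => (h i : ℂ))) :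
    ∃ c : ℂ, v = c • (fun i => (h i : ℂ)) := by
  obtain ⟨c, hc⟩ := aux_max' hq A hM hI h hpos hnull (fun j => (v j).re) a.re (by
    funext i
    rw [← aux_re, hv]; simp)
  obtain ⟨d, hd⟩ := aux_max' hq A hM hI h hpos hnull (fun j => (v j).im) a.im (by
    funext i
    rw [← aux_im, hv]; simp)
  refine ⟨⟨c, d⟩, ?_⟩
  funext i
  have h1 := congrFun hc i
  have h2 := congrFun hd i
  apply Complex.ext
  · simpa using h1
  · simpa using h2

theorem aux_neg {q : ℕ} (hq : 1 ≤ q) (A : Matrix (Fin q) (Fin q) ℝ)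
    (hM : ∀ i j : Fin q, i ≠ j → 0 ≤ A i j)
    (hI : ∀ S : Set (Fin q), S.Nonempty → S ≠ Set.univ →
      ∃ i ∈ S, ∃ j, j ∉ S ∧ A i j ≠ 0)
    (h : Fin q → ℝ) (hpos : ∀ i, 0 < h i) (hnull : A.mulVec h = 0)
    (v : Fin q → ℂ) (hv0 : v ≠ 0) (z : ℂ)
    (hv : (A.map Complex.ofReal).mulVec v = z • v) (hz : 0 ≤ z.re) : z = 0 := by
  have hsum : ∀ i, A.mulVec (fun j => ‖v j‖) i
      = A i i * ‖v i‖ + ∑ j ∈ Finset.univ.erase i, A i j * ‖v j‖ := by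
    intro i
    simp only [Matrix.mulVec, dotProduct]
    rw [Finset.add_sum_erase _ (fun j => A i j * ‖v j‖) (Finset.mem_univ i)]
  have hrow : ∀ i, ‖z - A i i‖ * ‖v i‖ ≤ ∑ j ∈ Finset.univ.erase i, A i j * ‖v j‖ := by
    intro i
    have h1 := congrFun hv i
    simp only [Matrix.mulVec, dotProduct, Matrix.map_apply, Pi.smul_apply, smul_eq_mul] at h1
    rw [← Finset.add_sum_erase _ _ (Finset.mem_univ i)] at h1
    have h2 : (z - A i i) * v i = ∑ j ∈ Finset.univ.erase i, (A i j : ℂ) * v j := by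
      linear_combination -h1
    rw [← norm_mul, h2]
    refine (norm_sum_le _ _).trans (Finset.sum_le_sum fun j hj => ?_)
    rw [norm_mul, Complex.norm_real, Real.norm_of_nonneg]
    exact hM i j (Finset.ne_of_mem_erase hj).symm
  have hre : ∀ i, z.re - A i i ≤ ‖z - A i i‖ := by
    intro i
    simpa using Complex.re_le_norm (z - A i i)
  obtain ⟨c, hc⟩ := aux_max hq A hM hI h hpos hnull (fun j => ‖v j‖) (by
    intro i
    rw [hsum]
    have := hrow i
    have := mul_le_mul_of_nonneg_right (hre i) (norm_nonneg (v i))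
    have := mul_nonneg hz (norm_nonneg (v i))
    linarith)
  obtain ⟨i, hi⟩ := Function.ne_iff.mp hv0
  have hvi : 0 < ‖v i‖ := norm_pos_iff.mpr hi
  have h0 : A.mulVec (fun j => ‖v j‖) i = 0 := by
    rw [hc, Matrix.mulVec_smul, hnull]; simp
  rw [hsum] at h0
  have h4 : ‖z - A i i‖ ≤ - A i i := by
    have := hrow i
    refine le_of_mul_le_mul_right ?_ hvi
    linarith
  have ha : 0 ≤ - A i i := (norm_nonneg _).trans h4
  have h5 : ‖z - A i i‖ ^ 2 ≤ (- A i i) ^ 2 := pow_le_pow_left₀ (norm_nonneg _) h4 2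
  rw [Complex.sq_norm, Complex.normSq_apply] at h5
  simp only [Complex.sub_re, Complex.ofReal_re, Complex.sub_im, Complex.ofReal_im, sub_zero] at h5
  have h6 := mul_nonneg hz ha
  apply Complex.ext
  · simp only [Complex.zero_re]; nlinarith [sq_nonneg z.re, sq_nonneg z.im]
  · simp only [Complex.zero_im]; nlinarith [sq_nonneg z.re, sq_nonneg z.im]

/-- If `A` is an irreducible Metzler matrix and `h_eq` is a nonzero
nonnegative vector with `A h_eq = 0`, then `0` is a simple root of the characteristic
polynomial of `A` over `ℂ`, and every other complex eigenvalue of `A` has strictly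
negative real part. -/
theorem stmt_1 (q : ℕ) (hq : 1 ≤ q) (A : Matrix (Fin q) (Fin q) ℝ)
    (hMetzler : ∀ i j : Fin q, i ≠ j → 0 ≤ A i j)
    (hIrred : ∀ S : Set (Fin q), S.Nonempty → S ≠ Set.univ →
      ∃ i ∈ S, ∃ j, j ∉ S ∧ A i j ≠ 0)
    (heq : Fin q → ℝ) (hne : heq ≠ 0) (hnn : ∀ i, 0 ≤ heq i)
    (hnull : A.mulVec heq = 0) :
    Polynomial.rootMultiplicity 0 (Matrix.charpoly (A.map Complex.ofReal)) = 1 ∧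
    ∀ z : ℂ, (Matrix.charpoly (A.map Complex.ofReal)).IsRoot z → z ≠ 0 → z.re < 0 := by
  have hpos := aux_pos A hMetzler hIrred heq hne hnn hnull
  set f : Module.End ℂ (Fin q → ℂ) := Matrix.toLin' (A.map Complex.ofReal) with hf
  have hfc : f.charpoly = Matrix.charpoly (A.map Complex.ofReal) := by
    rw [hf, Matrix.charpoly_toLin']
  rw [← hfc]
  constructor
  · set g : Fin q → ℂ := fun i => (heq i : ℂ) with hg
    have hfg : f g = 0 := by
      rw [hf, Matrix.toLin'_apply]
      funext i
      apply Complex.ext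
      · rw [aux_re]; simpa [hg] using congrFun hnull i
      · rw [aux_im]; simp [hg, Matrix.mulVec, dotProduct]
    have hg0 : g ≠ 0 := by
      intro h
      have h1 := congrFun h ⟨0, hq⟩
      have h2 := (hpos ⟨0, hq⟩).ne'
      simp [hg] at h1
      exact h2 h1
    have hker : ∀ (v : Fin q → ℂ) (a : ℂ), f v = a • g → ∃ c : ℂ, v = c • g := by
      intro v a hv
      rw [hf, Matrix.toLin'_apply] at hv
      exact aux_cplx hq A hMetzler hIrred heq hpos hnull v a hv
    have hpow : ∀ k : ℕ, ∀ v, (f ^ k) v = 0 → ∃ c : ℂ, v = c • g := by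
      intro k
      induction k with
      | zero => intro v hv; exact ⟨0, by simpa using hv⟩
      | succ k ih =>
        intro v hv
        rw [pow_succ, Module.End.mul_apply] at hv
        obtain ⟨a, ha⟩ := ih _ hv
        exact hker v a ha
    have hspan : f.maxGenEigenspace 0 = Submodule.span ℂ {g} := by
      ext v
      rw [Module.End.mem_maxGenEigenspace, Submodule.mem_span_singleton]
      simp only [zero_smul, sub_zero]
      constructor
      · rintro ⟨k, hk⟩
        obtain ⟨c, hc⟩ := hpow k v hk
        exact ⟨c, hc.symm⟩
      · rintro ⟨c, rfl⟩
        exact ⟨1, by simp [hfg]⟩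
    rw [← LinearMap.finrank_maxGenEigenspace_eq, hspan, finrank_span_singleton hg0]
  · intro z hz hz0
    by_contra hre
    have hev : f.HasEigenvalue z := Module.End.hasEigenvalue_iff_isRoot_charpoly f z |>.mpr hz
    obtain ⟨v, hv⟩ := hev.exists_hasEigenvector
    have h1 := hv.apply_eq_smul
    rw [hf, Matrix.toLin'_apply] at h1
    exact hz0 (aux_neg hq A hMetzler hIrred heq hpos hnull v hv.2 z h1 (not_lt.mp hre))
end

section
/- Let q ≥ 1 and let A be a real q×q matrix that is Metzler (all off-diagonal entries nonnegative) and irreducible, and suppose h_eq ∈ ℝ^q is a nonzero vector with all components nonnegative satisfying A h_eq = 0. Then there exists a unique vector v_eq ∈ ℝ^q with all components strictly positive such that v_eqᵀ A = 0 (v_eq is a left null vector of A) and ⟨v_eq, h_eq⟩ = Σ_{i=1}^q v_{eq,i} h_{eq,i} = 1. -/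
theorem aux_nonneg {q : ℕ} (A : Matrix (Fin q) (Fin q) ℝ)
    (hM : ∀ i j : Fin q, i ≠ j → 0 ≤ A i j)
    (hI : ∀ S : Set (Fin q), S.Nonempty → S ≠ Set.univ →
      ∃ i ∈ S, ∃ j, j ∉ S ∧ A i j ≠ 0)
    (u : Fin q → ℝ) (hu : ∀ i, 0 ≤ u i) (hA : ∀ j, ∑ i, u i * A i j = 0) :
    (∀ i, u i = 0) ∨ ∀ i, 0 < u i := by
  by_contra! hcon
  obtain ⟨⟨a, ha⟩, b, hb⟩ := hcon
  obtain ⟨i, hi, j, hj, hij⟩ := hI {i | 0 < u i} ⟨a, lt_of_le_of_ne (hu a) (Ne.symm ha)⟩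
    (fun h => absurd (h ▸ Set.mem_univ b : b ∈ {i | 0 < u i}) (not_lt.mpr hb))
  simp only [Set.mem_ofPred_eq, not_lt] at hi hj
  have hj0 : u j = 0 := le_antisymm hj (hu j)
  have hne : i ≠ j := by rintro rfl; linarith
  have hnn : ∀ k ∈ Finset.univ, 0 ≤ u k * A k j := by
    intro k _
    by_cases hk : k = j
    · subst hk; simp [hj0]
    · exact mul_nonneg (hu k) (hM k j hk)
  have h0 := (Finset.sum_eq_zero_iff_of_nonneg hnn).1 (hA j) i (Finset.mem_univ i)
  rcases mul_eq_zero.1 h0 with h | h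
  · linarith
  · exact hij h

theorem aux_right_pos {q : ℕ} (A : Matrix (Fin q) (Fin q) ℝ)
    (hM : ∀ i j : Fin q, i ≠ j → 0 ≤ A i j)
    (hI : ∀ S : Set (Fin q), S.Nonempty → S ≠ Set.univ →
      ∃ i ∈ S, ∃ j, j ∉ S ∧ A i j ≠ 0)
    (h : Fin q → ℝ) (hne : h ≠ 0) (hnn : ∀ i, 0 ≤ h i)
    (hA : ∀ i, ∑ j, A i j * h j = 0) : ∀ i, 0 < h i := by
  by_contra! hcon
  obtain ⟨a, ha⟩ := hcon
  obtain ⟨i, hi, j, hj, hij⟩ := hI {i | h i = 0} ⟨a, le_antisymm ha (hnn a)⟩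
    (fun hs => hne (funext fun b => (hs ▸ Set.mem_univ b : b ∈ {i | h i = 0})))
  simp only [Set.mem_ofPred_eq] at hi hj
  have hnn' : ∀ k ∈ Finset.univ, 0 ≤ A i k * h k := by
    intro k _
    by_cases hk : i = k
    · subst hk; simp [hi]
    · exact mul_nonneg (hM i k hk) (hnn k)
  have h0 := (Finset.sum_eq_zero_iff_of_nonneg hnn').1 (hA i) j (Finset.mem_univ j)
  rcases mul_eq_zero.1 h0 with h | h
  · exact hij h
  · exact hj h

/-- The positive part of a left null vector vanishes or is strictly positive. -/
theorem aux_pos_part {q : ℕ} (A : Matrix (Fin q) (Fin q) ℝ)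
    (hM : ∀ i j : Fin q, i ≠ j → 0 ≤ A i j)
    (hI : ∀ S : Set (Fin q), S.Nonempty → S ≠ Set.univ →
      ∃ i ∈ S, ∃ j, j ∉ S ∧ A i j ≠ 0)
    (h : Fin q → ℝ) (hpos : ∀ i, 0 < h i)
    (hA : ∀ i, ∑ j, A i j * h j = 0)
    (w : Fin q → ℝ) (hw : ∀ j, ∑ i, w i * A i j = 0) :
    (∀ i, w i ≤ 0) ∨ ∀ i, 0 < w i := by
  have hge : ∀ j, 0 ≤ ∑ i, max (w i) 0 * A i j := by
    intro j
    rcases le_or_gt (w j) 0 with hj | hj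
    · refine Finset.sum_nonneg fun k _ => ?_
      by_cases hk : k = j
      · subst hk; simp [max_eq_right hj]
      · exact mul_nonneg (le_max_right _ _) (hM k j hk)
    · refine (hw j).symm.le.trans ?_
      refine Finset.sum_le_sum fun k _ => ?_
      by_cases hk : k = j
      · subst hk; rw [max_eq_left hj.le]
      · exact mul_le_mul_of_nonneg_right (le_max_left _ _) (hM k j hk)
  have htot : ∑ j, (∑ i, max (w i) 0 * A i j) * h j = 0 := by
    simp only [Finset.sum_mul]
    rw [Finset.sum_comm]
    simp only [mul_assoc, ← Finset.mul_sum, hA, mul_zero, Finset.sum_const_zero]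
  have hz : ∀ j, ∑ i, max (w i) 0 * A i j = 0 := by
    intro j
    have := (Finset.sum_eq_zero_iff_of_nonneg
      (fun j _ => mul_nonneg (hge j) (hpos j).le)).1 htot j (Finset.mem_univ j)
    exact (mul_eq_zero.1 this).resolve_right (hpos j).ne'
  rcases aux_nonneg A hM hI (fun i => max (w i) 0) (fun i => le_max_right _ _) hz with h1 | h1
  · exact Or.inl fun i => max_eq_right_iff.1 (h1 i)
  · exact Or.inr fun i => (lt_max_iff.1 (h1 i)).resolve_right (lt_irrefl _)

theorem aux_tri {q : ℕ} (A : Matrix (Fin q) (Fin q) ℝ)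
    (hM : ∀ i j : Fin q, i ≠ j → 0 ≤ A i j)
    (hI : ∀ S : Set (Fin q), S.Nonempty → S ≠ Set.univ →
      ∃ i ∈ S, ∃ j, j ∉ S ∧ A i j ≠ 0)
    (h : Fin q → ℝ) (hpos : ∀ i, 0 < h i)
    (hA : ∀ i, ∑ j, A i j * h j = 0)
    (w : Fin q → ℝ) (hw : ∀ j, ∑ i, w i * A i j = 0) :
    w = 0 ∨ (∀ i, 0 < w i) ∨ ∀ i, 0 < -w i := by
  rcases aux_pos_part A hM hI h hpos hA w hw with h1 | h1
  · rcases aux_pos_part A hM hI h hpos hA (fun i => -w i)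
      (fun j => by simp [Finset.sum_neg_distrib, hw j]) with h2 | h2
    · exact Or.inl (funext fun i => le_antisymm (h1 i) (by have := h2 i; simpa using this))
    · exact Or.inr (Or.inr h2)
  · exact Or.inr (Or.inl h1)

/-- If `A` is an irreducible Metzler matrix and `h_eq` is a nonzero
nonnegative vector with `A h_eq = 0`, then there is a unique componentwise strictly
positive vector `v_eq` with `v_eqᵀ A = 0` and `⟨v_eq, h_eq⟩ = 1`. -/
theorem stmt_2 (q : ℕ) (hq : 1 ≤ q) (A : Matrix (Fin q) (Fin q) ℝ)
    (hMetzler : ∀ i j : Fin q, i ≠ j → 0 ≤ A i j)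
    (hIrred : ∀ S : Set (Fin q), S.Nonempty → S ≠ Set.univ →
      ∃ i ∈ S, ∃ j, j ∉ S ∧ A i j ≠ 0)
    (heq : Fin q → ℝ) (hne : heq ≠ 0) (hnn : ∀ i, 0 ≤ heq i)
    (hnull : A.mulVec heq = 0) :
    ∃! v : Fin q → ℝ, (∀ i, 0 < v i) ∧ Matrix.vecMul v A = 0 ∧ ∑ i, v i * heq i = 1 := by
  have hA : ∀ i, ∑ j, A i j * heq j = 0 := fun i => congrFun hnull i
  have hpos := aux_right_pos A hMetzler hIrred heq hne hnn hA
  have hnE : (Finset.univ : Finset (Fin q)).Nonempty := ⟨⟨0, hq⟩, Finset.mem_univ _⟩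
  have hsum : ∀ w : Fin q → ℝ, (∀ i, 0 < w i) → 0 < ∑ i, w i * heq i :=
    fun w hw => Finset.sum_pos (fun i _ => mul_pos (hw i) (hpos i)) hnE
  have tri := aux_tri A hMetzler hIrred heq hpos hA
  obtain ⟨u, hu, huA⟩ : ∃ u : Fin q → ℝ, (∀ i, 0 < u i) ∧ Matrix.vecMul u A = 0 := by
    have hdet : A.det = 0 := Matrix.exists_mulVec_eq_zero_iff.1 ⟨heq, hne, hnull⟩
    obtain ⟨w, hw0, hwA⟩ := Matrix.exists_vecMul_eq_zero_iff.2 hdet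
    rcases tri w (fun j => congrFun hwA j) with h | h | h
    · exact absurd h hw0
    · exact ⟨w, h, hwA⟩
    · exact ⟨-w, h, by rw [Matrix.neg_vecMul, hwA, neg_zero]⟩
  have hs := hsum u hu
  refine ⟨(∑ i, u i * heq i)⁻¹ • u, ⟨fun i => ?_, ?_, ?_⟩, ?_⟩
  · exact mul_pos (inv_pos.2 hs) (hu i)
  · rw [Matrix.smul_vecMul, huA, smul_zero]
  · simp only [Pi.smul_apply, smul_eq_mul, mul_assoc, ← Finset.mul_sum]
    exact inv_mul_cancel₀ hs.ne'
  · rintro v ⟨hv, hvA, hv1⟩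
    set s := ∑ i, u i * heq i with hsdef
    have hd1 : ∑ i, (v - s⁻¹ • u) i * heq i = 0 := by
      simp only [Pi.sub_apply, Pi.smul_apply, smul_eq_mul, sub_mul, Finset.sum_sub_distrib,
        mul_assoc, ← Finset.mul_sum, hv1]
      rw [← hsdef, inv_mul_cancel₀ hs.ne', sub_self]
    have hdA : Matrix.vecMul (v - s⁻¹ • u) A = 0 := by
      rw [Matrix.sub_vecMul, Matrix.smul_vecMul, huA, hvA, smul_zero, sub_zero]
    rcases tri _ (fun j => congrFun hdA j) with h | h | h
    · exact sub_eq_zero.1 h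
    · exact absurd hd1 (hsum _ h).ne'
    · have h3 := hsum (fun i => -(v - s⁻¹ • u) i) h
      simp only [neg_mul, Finset.sum_neg_distrib, hd1, neg_zero, lt_irrefl] at h3
end

section
/- Let q ≥ 1, let A be a real q×q matrix, and let h ∈ ℝ^q satisfy A h = 0 and Σ_{i=1}^q h_i ≠ 0. Define the q×q matrix G = (I_q − h 1_qᵀ / ⟨1_q, h⟩) A, where 1_q is the all-ones vector and ⟨1_q, h⟩ = Σ_i h_i. Then G has the same characteristic polynomial as A; in particular G and A have exactly the same complex eigenvalues with the same algebraic multiplicities. -/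
/-- If `A h = 0` and `∑ i, h i ≠ 0`, then the matrix
`G = (I − h 1ᵀ / ⟨1, h⟩) A` has the same characteristic polynomial as `A`; in
particular the complexifications of `G` and `A` have the same eigenvalues with the
same algebraic multiplicities. -/
theorem stmt_3 (q : ℕ) (hq : 1 ≤ q) (A : Matrix (Fin q) (Fin q) ℝ)
    (h : Fin q → ℝ) (hnull : A.mulVec h = 0) (hsum : ∑ i, h i ≠ 0)
    (G : Matrix (Fin q) (Fin q) ℝ)
    (hG : G = ((1 : Matrix (Fin q) (Fin q) ℝ) -
      (∑ i, h i)⁻¹ • Matrix.vecMulVec h (fun _ => (1 : ℝ))) * A) :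
    Matrix.charpoly G = Matrix.charpoly A ∧
    ∀ z : ℂ, Polynomial.rootMultiplicity z (Matrix.charpoly (G.map Complex.ofReal)) =
      Polynomial.rootMultiplicity z (Matrix.charpoly (A.map Complex.ofReal)) := by
  have key : Matrix.charpoly G = Matrix.charpoly A := by
    rw [hG, Matrix.charpoly_mul_comm, Matrix.mul_sub, Matrix.mul_one, Matrix.mul_smul,
      Matrix.mul_vecMulVec, hnull, Matrix.zero_vecMulVec, smul_zero, sub_zero]
  refine ⟨key, fun z => ?_⟩
  have e1 := Matrix.charpoly_map G Complex.ofRealHom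
  have e2 := Matrix.charpoly_map A Complex.ofRealHom
  have e : (G.map Complex.ofReal).charpoly = (A.map Complex.ofReal).charpoly := by
    rw [key] at e1
    exact e1.trans e2.symm
  rw [e]
end

section
/- Under the stated density-regulation assumptions, there exist an open neighborhood V of h_eq contained in the positive orthant and a real-analytic function Λ : V → ℝ^q such that Λ(h_eq) = v_eq and, for every h ∈ V, A(h)ᵀ Λ(h) + [JΛ(h)] θ(h) = 0, where [JΛ(h)] denotes the Jacobian matrix (total derivative) of Λ at h. -/
/-- The interaction matrix `A(h)` with entries `A_{ij}(h) = β_{ji}(h)` for `i ≠ j`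
and `A_{ii}(h) = β_{ii}(h) − ρ_i(h)`. -/
noncomputable def interactionMatrix (q : ℕ) (β : Fin q → Fin q → (Fin q → ℝ) → ℝ)
    (ρ : Fin q → (Fin q → ℝ) → ℝ) (h : Fin q → ℝ) : Matrix (Fin q) (Fin q) ℝ :=
  Matrix.of fun i j => if i = j then β i i h - ρ i h else β j i h

/-- The density-regulation vector field `θ(h) = A(h) h`. -/
noncomputable def densityField (q : ℕ) (β : Fin q → Fin q → (Fin q → ℝ) → ℝ)
    (ρ : Fin q → (Fin q → ℝ) → ℝ) (h : Fin q → ℝ) : Fin q → ℝ :=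
  (interactionMatrix q β ρ h).mulVec h


set_option linter.unusedSectionVars false

namespace DR
open scoped ENNReal NNReal Topology

abbrev L1 (I F : Type*) [NormedAddCommGroup F] := lp (fun _ : I => F) 1

section l1
variable {I F X : Type*} [NormedAddCommGroup F] [NormedSpace ℝ F]
  [NormedAddCommGroup X] [NormedSpace ℝ X] [CompleteSpace X]

lemma l1_hasSum (g : L1 I F) : HasSum (fun i => ‖g i‖) ‖g‖ := by
  have := lp.hasSum_norm (p := 1) (by simp) g
  simpa using this

/-- Operators on `ℓ¹` from a uniformly bounded family. -/
lemma l1_lift (T : I → F →L[ℝ] X) (k : ℝ) (hk : 0 ≤ k) (hT : ∀ i f, ‖T i f‖ ≤ k * ‖f‖) :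
    ∃ S : L1 I F →L[ℝ] X, ‖S‖ ≤ k ∧ ∀ g : L1 I F, HasSum (fun i => T i (g i)) (S g) := by
  have hs : ∀ g : L1 I F, Summable (fun i => T i (g i)) := fun g =>
    Summable.of_norm_bounded ((l1_hasSum g).summable.mul_left k) (fun i => hT i _)
  let S0 : L1 I F →ₗ[ℝ] X :=
    { toFun := fun g => ∑' i, T i (g i)
      map_add' := fun g g' => by
        rw [← (hs g).tsum_add (hs g')]
        simp
      map_smul' := fun c g => by
        rw [RingHom.id_apply, ← (hs g).tsum_const_smul c]
        simp }
  have hb : ∀ g, ‖S0 g‖ ≤ k * ‖g‖ := fun g =>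
    tsum_of_norm_bounded ((l1_hasSum g).mul_left k) (fun i => hT i _)
  exact ⟨S0.mkContinuous k hb, S0.mkContinuous_norm_le hk hb, fun g => (hs g).hasSum⟩

variable [DecidableEq I]

noncomputable def l1single (i : I) : F →L[ℝ] L1 I F :=
  (lp.lsingle (𝕜 := ℝ) (E := fun _ : I => F) 1 i).mkContinuous 1 (fun f => by
    have := lp.norm_single (E := fun _ : I => F) (p := 1) (by simp) i f
    rw [one_mul]; exact this.le)

lemma l1single_apply (i : I) (f : F) (j : I) :
    l1single i f j = if j = i then f else 0 := by
  change lp.single (E := fun _ : I => F) 1 i f j = _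
  rw [lp.single_apply]
  simp [Pi.single_apply]

lemma l1single_norm (i : I) (f : F) : ‖l1single i f‖ = ‖f‖ :=
  lp.norm_single (E := fun _ : I => F) (p := 1) (by simp) i f

end l1

section core
variable {ι E F : Type*} [Fintype ι] [DecidableEq ι] [NormedAddCommGroup E] [NormedSpace ℝ E]
  [NormedAddCommGroup F] [NormedSpace ℝ F] [CompleteSpace F]

def mon (y : ι → ℝ) (α : ι → ℕ) : ℝ := ∏ a, y a ^ α a

lemma mon_add (y : ι → ℝ) (α β : ι → ℕ) : mon y (α + β) = mon y α * mon y β := by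
  simp [mon, pow_add, Finset.prod_mul_distrib]

lemma mon_abs_le (y : ι → ℝ) (hy : ∀ a, |y a| ≤ 1) (α : ι → ℕ) : |mon y α| ≤ 1 := by
  rw [mon, Finset.abs_prod]
  refine Finset.prod_le_one (fun _ _ => abs_nonneg _) (fun a _ => ?_)
  rw [abs_pow]
  exact pow_le_one₀ (abs_nonneg _) (hy a)

lemma mon_sub (y : ι → ℝ) (α : ι → ℕ) (a : ι) (h : α a ≠ 0) :
    mon y (α - Pi.single a 1) * y a = mon y α := by
  have : α = (α - Pi.single a 1) + Pi.single a 1 := by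
    ext b
    by_cases hb : b = a
    · subst hb; simp; omega
    · simp [hb]
  conv_rhs => rw [this, mon_add]
  congr 1
  simp [mon, Pi.single_apply, Finset.prod_ite_eq', pow_ite]

lemma mon_hasFDerivAt (l : ι → E →L[ℝ] ℝ) (α : ι → ℕ) (x : E) :
    HasFDerivAt (fun x => mon (fun a => l a x) α)
      (∑ a, ((α a : ℝ) * mon (fun a => l a x) (α - Pi.single a 1)) • l a) x := by
  have h1 : ∀ a ∈ (Finset.univ : Finset ι), HasFDerivAt (fun x => (l a x) ^ (α a))
      (((α a : ℝ) * (l a x) ^ (α a - 1)) • l a) x := by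
    intro a _
    have := ((l a).hasFDerivAt (x := x)).pow (α a)
    convert! this using 2
    simp
  have h2 := HasFDerivAt.finsetProd h1
  unfold mon
  refine h2.congr_fderiv (Finset.sum_congr rfl fun a _ => ?_)
  symm
  rw [smul_smul]
  congr 1
  rw [mul_left_comm]
  congr 1
  rw [← Finset.prod_erase_mul _ _ (Finset.mem_univ a)]
  congr 1
  · refine Finset.prod_congr rfl fun b hb => ?_
    simp [Finset.ne_of_mem_erase hb]
  · simp

def deg (α : ι → ℕ) : ℕ := ∑ a, α a


lemma exists_mm (n : ℕ) (α : ι → ℕ) (h : deg α = n) :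
    ∃ m : ContinuousMultilinearMap ℝ (fun _ : Fin n => (ι → ℝ)) ℝ,
      ‖m‖ ≤ 1 ∧ ∀ y, m (fun _ => y) = mon y α := by
  have hc : Fintype.card (Σ a, Fin (α a)) = n := by simp [← h, deg]
  let e : (Σ a, Fin (α a)) ≃ Fin n := Fintype.equivFinOfCardEq hc
  let m0 : ContinuousMultilinearMap ℝ (fun _ : (Σ a, Fin (α a)) => (ι → ℝ)) ℝ :=
    (ContinuousMultilinearMap.mkPiAlgebra ℝ (Σ a, Fin (α a)) ℝ).compContinuousLinearMap
      (fun s => ContinuousLinearMap.proj (R := ℝ) (φ := fun _ : ι => ℝ) s.1)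
  refine ⟨m0.domDomCongr e, ?_, ?_⟩
  · refine ContinuousMultilinearMap.opNorm_le_bound zero_le_one fun m => ?_
    have : (m0.domDomCongr e) m = ∏ s : (Σ a, Fin (α a)), m (e s) s.1 := by
      simp [m0]
    rw [this, Real.norm_eq_abs, Finset.abs_prod, one_mul, ← e.prod_comp (fun i => ‖m i‖)]
    exact Finset.prod_le_prod (fun _ _ => abs_nonneg _) (fun s _ => norm_le_pi_norm (m (e s)) s.1)
  · intro y
    have : (m0.domDomCongr e) (fun _ => y) = ∏ s : (Σ a, Fin (α a)), y s.1 := by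
      simp [m0]
    rw [this, Fintype.prod_sigma]
    simp [mon]

lemma analytic_mon_sum (c : (ι → ℕ) → F) (hc : Summable fun α => ‖c α‖) :
    AnalyticOnNhd ℝ (fun y : ι → ℝ => ∑' α, mon y α • c α) {y | ∀ a, |y a| < 1} := by
  choose mm hmn hmv using fun (n : ℕ) (α : {α : ι → ℕ // deg α = n}) => exists_mm n α.1 α.2
  have hfib : ∀ n, Summable fun α : {α : ι → ℕ // deg α = n} => ‖c α.1‖ := fun n =>
    hc.comp_injective Subtype.val_injective
  have hb : ∀ n (α : {α : ι → ℕ // deg α = n}), ‖(mm n α).smulRight (c α.1)‖ ≤ ‖c α.1‖ := by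
    intro n α
    refine ContinuousMultilinearMap.opNorm_le_bound (norm_nonneg _) fun m => ?_
    rw [ContinuousMultilinearMap.smulRight_apply, norm_smul]
    have h1 := (mm n α).le_opNorm m
    have h2 : 0 ≤ ∏ i, ‖m i‖ := Finset.prod_nonneg fun _ _ => norm_nonneg _
    have h3 : ‖mm n α m‖ ≤ ∏ i, ‖m i‖ := by nlinarith [hmn n α]
    rw [mul_comm]
    exact mul_le_mul_of_nonneg_left h3 (norm_nonneg _)
  have hs : ∀ n, Summable fun α : {α : ι → ℕ // deg α = n} => (mm n α).smulRight (c α.1) :=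
    fun n => Summable.of_norm_bounded (hfib n) (hb n)
  let p : FormalMultilinearSeries ℝ (ι → ℝ) F := fun n =>
    ∑' α : {α : ι → ℕ // deg α = n}, (mm n α).smulRight (c α.1)
  have hp : ∀ n, ‖p n‖ ≤ ∑' α, ‖c α‖ := by
    intro n
    refine (tsum_of_norm_bounded (hfib n).hasSum (hb n)).trans ?_
    exact Summable.tsum_le_tsum_of_inj (fun α => α.1) Subtype.val_injective
      (fun _ _ => norm_nonneg _) (fun _ => le_rfl) (hfib n) hc
  have hball : HasFPowerSeriesOnBall (fun y : ι → ℝ => ∑' α, mon y α • c α) p 0 1 := by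
    refine ⟨?_, one_pos, ?_⟩
    · have := p.le_radius_of_bound (∑' α, ‖c α‖) (r := 1) (fun n => by simpa using hp n)
      simpa using this
    · intro y hy
      have hy' : ∀ a, |y a| ≤ 1 := by
        intro a
        have h1 : ‖y‖ < 1 := by
          rw [Metric.mem_eball, edist_zero_right] at hy
          have := hy
          rw [← ofReal_norm, ENNReal.ofReal_lt_one] at this
          exact this
        exact (norm_le_pi_norm y a).trans h1.le
      have hsum : Summable fun α => mon y α • c α := by
        refine Summable.of_norm_bounded hc fun α => ?_
        rw [norm_smul]
        have := mon_abs_le y hy' α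
        exact mul_le_of_le_one_left (norm_nonneg _) this
      have h1 := hsum.hasSum
      rw [← (Equiv.sigmaFiberEquiv (deg (ι := ι))).hasSum_iff] at h1
      rw [zero_add]
      refine h1.sigma fun n => ?_
      have h2 := (hs n).hasSum
      have h3 := (ContinuousMultilinearMap.apply ℝ (fun _ : Fin n => (ι → ℝ)) F
        (fun _ => y)).hasSum h2
      convert! h3 using 2 with α
      change mon y α.1 • c α.1 = mm n α (fun _ => y) • c α.1
      rw [hmv]
  refine hball.analyticOnNhd.mono fun y hy => ?_
  rw [Metric.mem_eball, edist_zero_right, ← ofReal_norm, ENNReal.ofReal_lt_one]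
  exact (pi_norm_lt_iff one_pos).2 fun a => hy a


lemma clm_hasSum_apply {J X Y : Type*} [NormedAddCommGroup X] [NormedSpace ℝ X]
    [NormedAddCommGroup Y] [NormedSpace ℝ Y] {T : J → Y →L[ℝ] X} {S : Y →L[ℝ] X}
    (h : HasSum T S) (f : Y) : HasSum (fun j => T j f) (S f) :=
  (ContinuousLinearMap.apply ℝ X f).hasSum h

lemma exists_shift (β : ι → ℕ) (b : (ι → ℕ) → F →L[ℝ] F) (hb : Summable fun α => ‖b α‖)
    (b0 : ℝ) (hb0 : ∑' α, ‖b α‖ ≤ b0) :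
    ∃ S : F →L[ℝ] L1 (ι → ℕ) F, (∀ f, ‖S f‖ ≤ b0 * ‖f‖) ∧
      ∀ f, HasSum (fun α => l1single (β + α) (b α f)) (S f) := by
  have hn : ∀ α, ‖(l1single (F := F) (β + α)).comp (b α)‖ ≤ ‖b α‖ := by
    intro α
    refine ContinuousLinearMap.opNorm_le_bound _ (norm_nonneg _) fun f => ?_
    rw [ContinuousLinearMap.comp_apply, l1single_norm]
    exact (b α).le_opNorm f
  have hs : Summable fun α => (l1single (F := F) (β + α)).comp (b α) :=
    Summable.of_norm_bounded hb hn
  refine ⟨∑' α, (l1single (F := F) (β + α)).comp (b α), fun f => ?_, fun f => ?_⟩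
  · refine (ContinuousLinearMap.le_opNorm _ f).trans ?_
    gcongr
    exact (tsum_of_norm_bounded hb.hasSum hn).trans hb0
  · exact clm_hasSum_apply hs.hasSum f

lemma exists_ev (y : ι → ℝ) (hy : ∀ a, |y a| ≤ 1) :
    ∃ S : L1 (ι → ℕ) F →L[ℝ] F, (∀ g : L1 (ι → ℕ) F, HasSum (fun α => mon y α • g α) (S g)) ∧
      ∀ β f, S (l1single β f) = mon y β • f := by
  obtain ⟨S, -, hS⟩ := l1_lift (I := ι → ℕ) (F := F) (X := F)
    (fun α => mon y α • ContinuousLinearMap.id ℝ F) 1 zero_le_one (fun α f => by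
      simp only [smul_apply, ContinuousLinearMap.id_apply, norm_smul]
      exact mul_le_mul_of_nonneg_right (mon_abs_le y hy α) (norm_nonneg _))
  refine ⟨S, fun g => by simpa using hS g, fun β f => ?_⟩
  have h := hS (l1single β f)
  refine h.unique ?_
  have h2 := hasSum_single (f := fun α => (mon y α • ContinuousLinearMap.id ℝ F)
    ((l1single β f : L1 (ι → ℕ) F) α)) β (fun α hα => by
      rw [l1single_apply, if_neg hα, map_zero])
  convert h2 using 1
  rw [l1single_apply, if_pos rfl]
  simp

theorem core_thm (l : ι → E →L[ℝ] ℝ) (η : ℝ) (hη : 0 < η) (W : E → E)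
    (w : ι → (ι → ℕ) → ℝ) (ω : ℝ) (hω : 0 ≤ ω)
    (hws : ∀ a, Summable fun α => ‖w a α‖) (hwn : ∀ a, ∑' α, ‖w a α‖ ≤ ω)
    (hW : ∀ x, (∀ a, |l a x| ≤ 1) → ∀ a,
      HasSum (fun α => mon (fun a => l a x) α * w a α) (l a (W x)))
    (B : E → F →L[ℝ] F) (b : (ι → ℕ) → F →L[ℝ] F) (b0 : ℝ)
    (hbs : Summable fun α => ‖b α‖) (hbn : ∑' α, ‖b α‖ ≤ b0)
    (hB : ∀ x, (∀ a, |l a x| ≤ 1) → HasSum (fun α => mon (fun a => l a x) α • b α) (B x))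
    (hW0 : W 0 = 0) (hB0 : B 0 = 0)
    (At : F →L[ℝ] F) (v : F) (hv : At v = 0)
    (Res : ℕ → F →L[ℝ] F)
    (hRes : ∀ k : ℕ, 1 ≤ k → ∀ f, ((k : ℝ) / η) • Res k f - At (Res k f) = f)
    (hResn : ∀ k : ℕ, 1 ≤ k → ∀ f, ((k : ℝ) / η) * ‖Res k f‖ ≤ ‖f‖)
    (hsmall : η * (ω + b0) < 1) :
    ∃ u : E → F, AnalyticOnNhd ℝ u {x | ∀ a, |l a x| < 1} ∧ u 0 = 0 ∧
      ∀ x, (∀ a, |l a x| < 1) →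
        (At + B x) (v + u x) + fderiv ℝ u x (W x - η⁻¹ • x) = 0 := by
  have hb0 : 0 ≤ b0 := (tsum_nonneg fun _ => norm_nonneg _).trans hbn
  let R : (ι → ℕ) → F →L[ℝ] F := fun α => if deg α = 0 then 0 else Res (deg α)
  have hR1 : ∀ α f, (deg α : ℝ) * ‖R α f‖ ≤ η * ‖f‖ := by
    intro α f
    by_cases h : deg α = 0
    · simp only [h]; simp; positivity
    · have := hResn (deg α) (Nat.one_le_iff_ne_zero.2 h) f
      simp only [R, if_neg h]
      rw [div_mul_eq_mul_div, div_le_iff₀ hη] at this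
      linarith
  have hR2 : ∀ α f, ‖R α f‖ ≤ η * ‖f‖ := by
    intro α f
    by_cases h : deg α = 0
    · simp only [R, if_pos h]; simp; positivity
    · refine le_trans ?_ (hR1 α f)
      have : (1 : ℝ) ≤ deg α := by exact_mod_cast Nat.one_le_iff_ne_zero.2 h
      exact le_mul_of_one_le_left (norm_nonneg _) this
  choose Sw hSw1 hSw2 using fun (a : ι) (β : ι → ℕ) =>
    exists_shift (F := F) β (fun α => w a α • ContinuousLinearMap.id ℝ F)
      (Summable.of_nonneg_of_le (fun _ => norm_nonneg _) (fun α => by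
        rw [norm_smul]
        exact mul_le_of_le_one_right (norm_nonneg _) ContinuousLinearMap.norm_id_le) (hws a)) ω
      (le_trans (Summable.tsum_le_tsum (fun α => by
        rw [norm_smul]
        exact mul_le_of_le_one_right (norm_nonneg _) ContinuousLinearMap.norm_id_le)
        (Summable.of_nonneg_of_le (fun _ => norm_nonneg _) (fun α => by
        rw [norm_smul]
        exact mul_le_of_le_one_right (norm_nonneg _) ContinuousLinearMap.norm_id_le) (hws a))
        (hws a)) (hwn a))
  choose Sb hSb1 hSb2 using fun (β : ι → ℕ) => exists_shift (F := F) β b hbs b0 hbn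
  obtain ⟨T, hTn, hT⟩ := l1_lift (I := ι → ℕ) (F := F) (X := L1 (ι → ℕ) F)
    (fun α => (∑ a, (α a : ℝ) • (Sw a (α - Pi.single a 1)).comp (R α)) + (Sb α).comp (R α))
    (η * (ω + b0)) (by positivity) (fun α f => by
      have h1 : ‖∑ a, (α a : ℝ) • (Sw a (α - Pi.single a 1)) (R α f)‖
          ≤ ∑ a, (α a : ℝ) * (ω * ‖R α f‖) := by
        refine norm_sum_le_of_le _ fun a _ => ?_
        rw [norm_smul, Real.norm_natCast]
        exact mul_le_mul_of_nonneg_left (hSw1 _ _ _) (Nat.cast_nonneg _)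
      have h2 : ∑ a, (α a : ℝ) * (ω * ‖R α f‖) = ω * ((deg α : ℝ) * ‖R α f‖) := by
        rw [← Finset.sum_mul, deg]; push_cast; ring
      have h3 := hSb1 α (R α f)
      simp only [add_apply, sum_apply,
        smul_apply, ContinuousLinearMap.comp_apply]
      refine (norm_add_le _ _).trans ?_
      have h4 := mul_le_mul_of_nonneg_left (hR1 α f) hω
      have h5 := mul_le_mul_of_nonneg_left (hR2 α f) hb0
      linarith)
  -- the fixed point
  obtain ⟨g, hg⟩ : ∃ g : L1 (ι → ℕ) F, g - T g = Sb 0 v := by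
    let U := Units.oneSub T (lt_of_le_of_lt hTn hsmall)
    refine ⟨(↑U⁻¹ : L1 (ι → ℕ) F →L[ℝ] L1 (ι → ℕ) F) (Sb 0 v), ?_⟩
    have h := U.mul_inv
    have h2 := congrArg (fun S : L1 (ι → ℕ) F →L[ℝ] L1 (ι → ℕ) F => S (Sb 0 v)) h
    simpa [U, ContinuousLinearMap.mul_apply'] using h2
  have hgs : Summable fun α => ‖g α‖ := (l1_hasSum g).summable
  let c : (ι → ℕ) → F := fun α => R α (g α)
  have hcs : Summable fun α => ‖c α‖ :=
    Summable.of_nonneg_of_le (fun _ => norm_nonneg _) (fun α => hR2 α (g α)) (hgs.mul_left η)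
  let u : E → F := fun x => ∑' α, mon (fun a => l a x) α • c α
  have han : AnalyticOnNhd ℝ u {x | ∀ a, |l a x| < 1} := by
    have h1 := analytic_mon_sum c hcs
    have h2 : AnalyticOnNhd ℝ (fun x => ContinuousLinearMap.pi l x) {x | ∀ a, |l a x| < 1} :=
      (ContinuousLinearMap.pi l).analyticOnNhd _
    exact h1.comp h2 (fun x hx => hx)
  have hmon0 : ∀ α : ι → ℕ, α ≠ 0 → mon (fun a => l a (0 : E)) α = 0 := by
    intro α hα
    obtain ⟨a, ha⟩ := Function.ne_iff.1 hα
    exact Finset.prod_eq_zero (Finset.mem_univ a) (by simpa using ha)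
  have hu0 : u 0 = 0 := by
    have : ∀ α, mon (fun a => l a (0 : E)) α • c α = 0 := by
      intro α
      by_cases h : α = 0
      · subst h; simp [c, R, deg]
      · rw [hmon0 α h, zero_smul]
    change ∑' α, mon (fun a => l a (0 : E)) α • c α = 0
    simp only [this, tsum_zero]
  have hopen : IsOpen {x : E | ∀ a, |l a x| < 1} := by
    simp only [Set.ofPred_forall]
    exact isOpen_iInter_of_finite fun a =>
      isOpen_lt ((l a).continuous.abs) continuous_const
  have hconv : Convex ℝ {x : E | ∀ a, |l a x| < 1} := by
    simp only [Set.ofPred_forall]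
    refine convex_iInter fun a => ?_
    have := (convex_ball (0 : ℝ) 1).linear_preimage ((l a).toLinearMap)
    convert this using 1
    ext x; simp
  let D : (ι → ℕ) → E → E →L[ℝ] F := fun α x =>
    (∑ a, ((α a : ℝ) * mon (fun a => l a x) (α - Pi.single a 1)) • l a).smulRight (c α)
  have hDb : ∀ α x, x ∈ {x : E | ∀ a, |l a x| < 1} → ‖D α x‖ ≤ ((∑ a, ‖l a‖) * η) * ‖g α‖ := by
    intro α x hx
    simp only [D, ContinuousLinearMap.norm_smulRight_apply]
    have h1 : ‖∑ a, ((α a : ℝ) * mon (fun a => l a x) (α - Pi.single a 1)) • l a‖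
        ≤ ∑ a, (α a : ℝ) * ∑ a, ‖l a‖ := by
      refine norm_sum_le_of_le _ fun a _ => ?_
      rw [norm_smul, norm_mul, Real.norm_natCast, mul_assoc]
      refine mul_le_mul_of_nonneg_left ?_ (Nat.cast_nonneg _)
      refine (mul_le_of_le_one_left (norm_nonneg _)
        (mon_abs_le _ (fun a => (hx a).le) _)).trans ?_
      exact Finset.single_le_sum (f := fun a => ‖l a‖) (fun _ _ => norm_nonneg _)
        (Finset.mem_univ a)
    rw [← Finset.sum_mul] at h1
    have h2 := mul_le_mul_of_nonneg_right h1 (norm_nonneg (c α))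
    have h3 := mul_le_mul_of_nonneg_left (hR1 α (g α))
      (Finset.sum_nonneg fun a (_ : a ∈ Finset.univ) => norm_nonneg (l a))
    have h4 : (∑ a, (α a : ℝ)) = (deg α : ℝ) := by simp [deg]
    rw [h4] at h2
    change _ ≤ _ * ‖R α (g α)‖ at h2
    linarith
  have hDs : ∀ x, x ∈ {x : E | ∀ a, |l a x| < 1} → Summable fun α => D α x := fun x hx =>
    Summable.of_norm_bounded (hgs.mul_left _) (fun α => hDb α x hx)
  have hus : ∀ x, x ∈ {x : E | ∀ a, |l a x| < 1} →
      Summable fun α => mon (fun a => l a x) α • c α := by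
    intro x hx
    refine Summable.of_norm_bounded hcs fun α => ?_
    rw [norm_smul]
    exact mul_le_of_le_one_left (norm_nonneg _) (mon_abs_le _ (fun a => (hx a).le) α)
  have hder : ∀ x, x ∈ {x : E | ∀ a, |l a x| < 1} → HasFDerivAt u (∑' α, D α x) x := by
    intro x hx
    exact hasFDerivAt_tsum_of_isPreconnected (hgs.mul_left _) hopen hconv.isPreconnected
      (fun α x _ => (mon_hasFDerivAt l α x).smul_const (c α)) hDb hx (hus x hx) hx
  have hderapp : ∀ x, x ∈ {x : E | ∀ a, |l a x| < 1} → ∀ y,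
      HasSum (fun α => (∑ a, ((α a : ℝ) * mon (fun a => l a x) (α - Pi.single a 1)) * l a y) • c α)
        (fderiv ℝ u x y) := by
    intro x hx y
    rw [(hder x hx).fderiv]
    have := (ContinuousLinearMap.apply ℝ F y).hasSum (hDs x hx).hasSum
    convert! this using 2 with α
    simp [D]
  -- the functional equation
  have hfun : ∀ x (hx : ∀ a, |l a x| < 1),
      HasSum (fun α => mon (fun a => l a x) α • g α)
        (B x v + (fderiv ℝ u x (W x) + B x (u x))) := by
    intro x hx
    obtain ⟨S, hS1, hS2⟩ := exists_ev (F := F) (fun a => l a x) (fun a => (hx a).le)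
    have hSb : ∀ β f, S (Sb β f) = mon (fun a => l a x) β • B x f := by
      intro β f
      have h1 := S.hasSum (hSb2 β f)
      refine h1.unique ?_
      have h2 := ((ContinuousLinearMap.apply ℝ F f).hasSum (hB x (fun a => (hx a).le))).const_smul
        (mon (fun a => l a x) β)
      convert! h2 using 2 with α
      simp [hS2, mon_add, mul_smul]
    have hSw : ∀ a β f, S (Sw a β f) = (mon (fun a => l a x) β * l a (W x)) • f := by
      intro a β f
      have h1 := S.hasSum (hSw2 a β f)
      refine h1.unique ?_
      have h2 := ((hW x (fun a => (hx a).le) a).mul_left (mon (fun a => l a x) β)).smul_const f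
      convert! h2 using 2 with α
      simp only [smul_apply, ContinuousLinearMap.id_apply, hS2, mon_add, smul_smul]
      congr 1
      ring
    have hgeq : S g = B x v + (fderiv ℝ u x (W x) + B x (u x)) := by
      have h1 : S g = S (Sb 0 v) + S (T g) := by
        rw [← hg, map_sub]; abel
      rw [h1, hSb]
      congr 1
      · simp [mon]
      · have h2 := S.hasSum (hT g)
        refine h2.unique ?_
        have h3 := (hderapp x hx (W x)).add ((B x).hasSum (hus x hx).hasSum)
        convert! h3 using 2 with α
        simp only [add_apply, sum_apply,
          smul_apply, ContinuousLinearMap.comp_apply, map_add, map_sum,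
          map_smul, hSw, hSb]
        congr 1
        rw [Finset.sum_smul]
        refine Finset.sum_congr rfl fun a _ => ?_
        simp only [c, smul_smul]
        congr 1
        ring
    rw [← hgeq]
    exact hS1 g
  have hg0 : g 0 = 0 := by
    have h1 := hfun 0 (by simp)
    rw [hW0, hB0] at h1
    have h0 : (0 : F →L[ℝ] F) v + (fderiv ℝ u 0 0 + (0 : F →L[ℝ] F) (u 0)) = 0 := by simp
    rw [h0] at h1
    have h2 := hasSum_single (f := fun α => mon (fun a => l a (0 : E)) α • g α) 0
      (fun α hα => by rw [hmon0 α hα, zero_smul])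
    have h3 := h2.unique h1
    simpa [mon] using h3
  refine ⟨u, han, hu0, fun x hx => ?_⟩
  have hA : HasSum (fun α => mon (fun a => l a x) α • g α)
      (η⁻¹ • fderiv ℝ u x x - At (u x)) := by
    have h3 := ((hderapp x hx x).const_smul η⁻¹).sub (At.hasSum (hus x hx).hasSum)
    convert! h3 using 2 with α
    have h4 : (∑ a, ((α a : ℝ) * mon (fun a => l a x) (α - Pi.single a 1)) * l a x)
        = (deg α : ℝ) * mon (fun a => l a x) α := by
      rw [deg]; push_cast
      rw [Finset.sum_mul]
      refine Finset.sum_congr rfl fun a _ => ?_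
      by_cases ha : α a = 0
      · simp [ha]
      · rw [mul_assoc, mon_sub _ _ _ ha]
    rw [h4]
    by_cases h : deg α = 0
    · have : α = 0 := by
        ext a
        exact (Finset.sum_eq_zero_iff.1 h) a (Finset.mem_univ a)
      subst this
      simp [hg0, c]
    · have h5 := hRes (deg α) (Nat.one_le_iff_ne_zero.2 h) (g α)
      simp only [map_smul, c, R, if_neg h]
      conv_lhs => rw [← h5]
      rw [smul_sub, smul_smul, smul_smul]
      congr 2
      field_simp
  have hfin := hA.unique (hfun x hx)
  simp only [add_apply, map_add, map_sub, map_smul, hv, zero_add]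
  have : η⁻¹ • fderiv ℝ u x x
      = At (u x) + (B x v + (fderiv ℝ u x (W x) + B x (u x))) := by
    rw [← hfin]; abel
  rw [this]
  abel


def cnt {q : ℕ} (κ : Fin q → ι) (s : Σ n : ℕ, (Fin n → Fin q)) : ι → ℕ :=
  fun a => (Finset.univ.filter fun j => κ (s.2 j) = a).card

lemma mon_cnt {q : ℕ} (κ : Fin q → ι) (s : Σ n : ℕ, (Fin n → Fin q)) (y : ι → ℝ) :
    mon y (cnt κ s) = ∏ j, y (κ (s.2 j)) := by
  rw [mon, ← Finset.prod_fiberwise (s := Finset.univ) (g := fun j => κ (s.2 j))]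
  refine Finset.prod_congr rfl fun a _ => ?_
  rw [cnt, Finset.prod_congr rfl (g := fun _ => y a), Finset.prod_const]
  intro j hj
  rw [(Finset.mem_filter.1 hj).2]

set_option maxHeartbeats 1000000 in
lemma expand {q : ℕ} (κ : Fin q → ι) (f : (Fin q → ℝ) → F)
    (p : FormalMultilinearSeries ℝ (Fin q → ℝ) F) (hp : HasFPowerSeriesAt f p 0) (k : ℕ)
    (hk : ∀ i < k, p i = 0) :
    ∃ C R0 : ℝ, 0 ≤ C ∧ 0 < R0 ∧ ∀ ρ : ℝ, 0 < ρ → ρ ≤ R0 → ∃ c : (ι → ℕ) → F,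
      (Summable fun α => ‖c α‖) ∧ ∑' α, ‖c α‖ ≤ C * ρ ^ k ∧
      ∀ y : ι → ℝ, (∀ a, |y a| ≤ 1) →
        HasSum (fun α => mon y α • c α) (f (fun i => ρ * y (κ i))) := by
  obtain ⟨r, hr⟩ := hp
  obtain ⟨R1, hR1pos, hR1⟩ := ENNReal.lt_iff_exists_nnreal_btwn.1 hr.r_pos
  have hR1pos' : 0 < (R1 : ℝ) := by exact_mod_cast hR1pos
  have hsR := p.summable_norm_mul_pow (hR1.trans_le hr.r_le)
  set R0 : ℝ := R1 / (q + 1) with hR0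
  have hR0pos : 0 < R0 := by positivity
  have hqR0 : q * R0 ≤ R1 := by
    rw [hR0, mul_div_assoc', div_le_iff₀ (by positivity)]
    nlinarith
  have hR01 : R0 ≤ R1 := by
    rw [hR0, div_le_iff₀ (by positivity)]
    have : (0 : ℝ) ≤ q := Nat.cast_nonneg _
    nlinarith
  refine ⟨(R0 ^ k)⁻¹ * ∑' n, ‖p n‖ * (R1 : ℝ) ^ n, R0, ?_, hR0pos, ?_⟩
  · exact mul_nonneg (by positivity) (tsum_nonneg fun n => by positivity)
  intro ρ hρ hρ0
  let d : (Σ n : ℕ, (Fin n → Fin q)) → F := fun s =>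
    ρ ^ s.1 • p s.1 (fun j => Pi.single (s.2 j) (1 : ℝ))
  have hdn : ∀ s, ‖d s‖ ≤ ρ ^ s.1 * ‖p s.1‖ := by
    rintro ⟨n, w⟩
    simp only [d, norm_smul, norm_pow, Real.norm_eq_abs, abs_of_pos hρ]
    refine mul_le_mul_of_nonneg_left ?_ (by positivity)
    refine ((p n).le_opNorm _).trans ?_
    have h1 : ∏ j : Fin n, ‖(Pi.single (w j) (1 : ℝ) : Fin q → ℝ)‖ = 1 :=
      Finset.prod_eq_one fun j _ => by rw [Pi.norm_single, norm_one]
    rw [h1, mul_one]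
  have hlev : ∀ n, ∑ w : Fin n → Fin q, ‖d ⟨n, w⟩‖
      ≤ (R0 ^ k)⁻¹ * ρ ^ k * (‖p n‖ * (R1 : ℝ) ^ n) := by
    intro n
    by_cases hn : n < k
    · have : ∀ w : Fin n → Fin q, ‖d ⟨n, w⟩‖ = 0 := fun w => by simp [d, hk n hn]
      simp only [this, Finset.sum_const_zero]
      positivity
    · have h1 : ∑ w : Fin n → Fin q, ‖d ⟨n, w⟩‖ ≤ (q : ℝ) ^ n * (ρ ^ n * ‖p n‖) := by
        refine (Finset.sum_le_sum fun w _ => hdn ⟨n, w⟩).trans (le_of_eq ?_)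
        change ∑ _w : Fin n → Fin q, ρ ^ n * ‖p n‖ = _
        rw [Finset.sum_const, Finset.card_univ, Fintype.card_fun, Fintype.card_fin,
          Fintype.card_fin, nsmul_eq_mul]
        push_cast
        ring
      refine h1.trans ?_
      obtain ⟨m, rfl⟩ := Nat.exists_eq_add_of_le (not_lt.1 hn)
      have h2 : ρ ^ (k + m) ≤ (R0 ^ k)⁻¹ * ρ ^ k * R0 ^ (k + m) := by
        have : (R0 ^ k)⁻¹ * ρ ^ k * R0 ^ (k + m) = ρ ^ k * R0 ^ m := by
          rw [pow_add]; field_simp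
        rw [this, pow_add]
        gcongr
      have h3 : (q : ℝ) ^ (k + m) * R0 ^ (k + m) ≤ (R1 : ℝ) ^ (k + m) := by
        rw [← mul_pow]
        gcongr
      calc (q : ℝ) ^ (k + m) * (ρ ^ (k + m) * ‖p (k + m)‖)
          ≤ (q : ℝ) ^ (k + m) * (((R0 ^ k)⁻¹ * ρ ^ k * R0 ^ (k + m)) * ‖p (k + m)‖) := by gcongr
        _ = ((R0 ^ k)⁻¹ * ρ ^ k) * (‖p (k + m)‖ * ((q : ℝ) ^ (k + m) * R0 ^ (k + m))) := by ring
        _ ≤ _ := by gcongr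
  have hds : Summable fun s => ‖d s‖ := by
    rw [summable_sigma_of_nonneg (fun _ => norm_nonneg _)]
    refine ⟨fun n => (hasSum_fintype _).summable, ?_⟩
    refine Summable.of_nonneg_of_le (fun n => tsum_nonneg fun _ => norm_nonneg _) (fun n => ?_)
      (hsR.mul_left ((R0 ^ k)⁻¹ * ρ ^ k))
    rw [tsum_fintype]
    exact hlev n
  have hdt : ∑' s, ‖d s‖ ≤ ((R0 ^ k)⁻¹ * ∑' n, ‖p n‖ * (R1 : ℝ) ^ n) * ρ ^ k := by
    rw [hds.tsum_sigma]
    have h1 := Summable.tsum_le_tsum (f := fun n => ∑' w : Fin n → Fin q, ‖d ⟨n, w⟩‖)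
      (fun n => by rw [tsum_fintype]; exact hlev n) hds.sigma (hsR.mul_left ((R0 ^ k)⁻¹ * ρ ^ k))
    rw [tsum_mul_left] at h1
    linarith
  let e := Equiv.sigmaFiberEquiv (cnt κ)
  have hes : Summable fun t => ‖d (e t)‖ := e.summable_iff.2 hds
  have hfs : ∀ α, Summable fun s : {s // cnt κ s = α} => ‖d s.1‖ := fun α =>
    hds.comp_injective Subtype.val_injective
  let c : (ι → ℕ) → F := fun α => ∑' s : {s // cnt κ s = α}, d s.1
  have hcn : ∀ α, ‖c α‖ ≤ ∑' s : {s // cnt κ s = α}, ‖d s.1‖ := fun α =>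
    norm_tsum_le_tsum_norm (hfs α)
  have hsig : Summable fun α => ∑' s : {s // cnt κ s = α}, ‖d s.1‖ := hes.sigma
  have hcs : Summable fun α => ‖c α‖ :=
    Summable.of_nonneg_of_le (fun _ => norm_nonneg _) hcn hsig
  refine ⟨c, hcs, ?_, ?_⟩
  · refine (Summable.tsum_le_tsum hcn hcs hsig).trans (le_trans (le_of_eq ?_) hdt)
    rw [← e.tsum_eq, hes.tsum_sigma]
    rfl
  · intro y hy
    let x : Fin q → ℝ := fun i => ρ * y (κ i)
    have hsum : Summable fun s => mon y (cnt κ s) • d s := by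
      refine Summable.of_norm_bounded hds fun s => ?_
      rw [norm_smul]
      exact mul_le_of_le_one_left (norm_nonneg _) (mon_abs_le y hy _)
    have hfx : HasSum (fun n => p n fun _ => x) (f x) := by
      have hx : x ∈ Metric.eball (0 : Fin q → ℝ) r := by
        rw [Metric.mem_eball, edist_zero_right]
        refine lt_of_le_of_lt ?_ hR1
        rw [← ofReal_norm, ENNReal.ofReal_le_iff_le_toReal ENNReal.coe_ne_top]
        simp only [ENNReal.coe_toReal]
        refine (pi_norm_le_iff_of_nonneg hR1pos'.le).2 fun i => ?_
        simp only [x, norm_mul, Real.norm_eq_abs, abs_of_pos hρ]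
        have := hy (κ i)
        nlinarith [abs_nonneg (y (κ i))]
      have := hr.hasSum hx
      rwa [zero_add] at this
    have hpn : ∀ n, (p n fun _ => x) = ∑ w : Fin n → Fin q, mon y (cnt κ ⟨n, w⟩) • d ⟨n, w⟩ := by
      intro n
      have hx : x = ∑ i, x i • (Pi.single i (1 : ℝ) : Fin q → ℝ) := by
        ext j; simp [Finset.sum_apply, Pi.single_apply]
      have h1 : (p n fun _ => x) = p n fun _ => ∑ i, x i • (Pi.single i (1 : ℝ) : Fin q → ℝ) := by
        rw [← hx]
      rw [h1, ContinuousMultilinearMap.map_sum]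
      refine Finset.sum_congr rfl fun w _ => ?_
      rw [ContinuousMultilinearMap.map_smul_univ, mon_cnt]
      simp only [x, d, smul_smul, Finset.prod_mul_distrib, Finset.prod_const, Finset.card_univ,
        Fintype.card_fin]
      congr 1
      ring
    have h2 : HasSum (fun s => mon y (cnt κ s) • d s) (f x) := by
      have h3 := hsum.hasSum.sigma (fun n => hasSum_fintype _)
      have h4 : HasSum (fun n => p n fun _ => x) (∑' s, mon y (cnt κ s) • d s) := by
        convert! h3 using 2 with n
        exact hpn n
      rw [hfx.unique h4]
      exact hsum.hasSum
    rw [← e.hasSum_iff] at h2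
    refine h2.sigma fun α => ?_
    have h5 := ((Summable.of_norm (hfs α)).hasSum).const_smul (mon y α)
    convert! h5 using 2 with s
    change mon y (cnt κ s.1) • d s.1 = _
    rw [s.2]

end core
end DR
namespace DR
open scoped ENNReal NNReal Topology

section linalg
variable {q : ℕ}

lemma exists_resolvent (A : Matrix (Fin q) (Fin q) ℝ) (hoff : ∀ i j, i ≠ j → 0 ≤ A i j)
    (hrow : ∀ i, ∑ j, A i j = 0) (s : ℝ) (hs : 0 < s) :
    ∃ R : (Fin q → ℝ) →L[ℝ] (Fin q → ℝ),
      ∀ f, s • R f - A.mulVec (R f) = f ∧ s * ‖R f‖ ≤ ‖f‖ := by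
  let L : (Fin q → ℝ) →ₗ[ℝ] (Fin q → ℝ) := s • LinearMap.id - A.mulVecLin
  have hL : ∀ f, L f = s • f - A.mulVec f := fun f => by simp [L]
  have hbd : ∀ f, s * ‖f‖ ≤ ‖L f‖ := by
    intro f
    have key : ∀ i, ‖f‖ = |f i| → s * ‖f‖ ≤ ‖L f‖ := by
      intro i hi
      have h1 : |(L f) i| ≤ ‖L f‖ := norm_le_pi_norm (L f) i
      refine le_trans ?_ h1
      have h2 : (L f) i = s * f i + ∑ j, A i j * (f i - f j) := by
        rw [hL]
        simp only [Pi.sub_apply, Pi.smul_apply, smul_eq_mul, Matrix.mulVec, dotProduct, mul_sub,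
          Finset.sum_sub_distrib, ← Finset.sum_mul, hrow i]
        ring
      have hf : ∀ j, |f j| ≤ |f i| := fun j => by rw [← hi]; exact norm_le_pi_norm f j
      rw [h2, hi]
      rcases le_total 0 (f i) with h0 | h0
      · rw [abs_of_nonneg h0]
        have : 0 ≤ ∑ j, A i j * (f i - f j) := Finset.sum_nonneg fun j _ => by
          by_cases hij : i = j
          · subst hij; simp
          · have := hf j
            rw [abs_of_nonneg h0] at this
            exact mul_nonneg (hoff i j hij) (by linarith [le_abs_self (f j)])
        exact le_trans (by linarith) (le_abs_self _)
      · rw [abs_of_nonpos h0]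
        have : ∑ j, A i j * (f i - f j) ≤ 0 := Finset.sum_nonpos fun j _ => by
          by_cases hij : i = j
          · subst hij; simp
          · have := hf j
            rw [abs_of_nonpos h0] at this
            exact mul_nonpos_of_nonneg_of_nonpos (hoff i j hij) (by linarith [neg_abs_le (f j)])
        exact le_trans (by linarith) (neg_le_abs _)
    rcases isEmpty_or_nonempty (Fin q) with h | h
    · have : f = 0 := Subsingleton.elim _ _
      subst this; simp
    · obtain ⟨i, hi⟩ := Finite.exists_max (fun i => |f i|)
      refine key i (le_antisymm ?_ (norm_le_pi_norm f i))
      exact (pi_norm_le_iff_of_nonneg (abs_nonneg _)).2 hi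
  have hinj : Function.Injective L := by
    rw [injective_iff_map_eq_zero]
    intro f hf
    have := hbd f
    rw [hf, norm_zero] at this
    have h2 : ‖f‖ ≤ 0 := by
      by_contra h
      push Not at h
      nlinarith
    exact norm_le_zero_iff.1 h2
  let e := LinearEquiv.ofInjectiveEndo L hinj
  refine ⟨e.symm.toLinearMap.toContinuousLinearMap, fun f => ?_⟩
  have h1 : L (e.symm f) = f := e.apply_symm_apply f
  refine ⟨?_, ?_⟩
  · rw [← hL]; exact h1
  · have := hbd (e.symm f)
    rw [h1] at this
    exact this

attribute [local instance] Matrix.linftyOpNormedRing Matrix.linftyOpNormedAlgebra in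
lemma exists_contr (J : Matrix (Fin q) (Fin q) ℝ)
    (hst : ∀ z : ℂ, (Matrix.charpoly (J.map Complex.ofReal)).IsRoot z → z.re < 0) :
    ∃ η : ℝ, 0 < η ∧ ∃ n : ℕ, 1 ≤ n ∧ ∃ r : ℝ, 0 < r ∧ r < 1 ∧
      ∀ i, ∑ k, |((1 + η • J) ^ n) i k| ≤ r ^ n := by
  rcases isEmpty_or_nonempty (Fin q) with hemp | hne
  · exact ⟨1, one_pos, 1, le_rfl, 1/2, by norm_num, by norm_num, fun i => hemp.elim i⟩
  set Jc := J.map Complex.ofReal with hJc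
  have h0 : Jc.charpoly ≠ 0 := Jc.charpoly_monic.ne_zero
  have hev : ∀ᶠ η : ℝ in 𝓝[>] 0, ∀ z ∈ Jc.charpoly.roots.toFinset, ‖1 + (η : ℂ) * z‖ < 1 := by
    rw [Filter.eventually_all_finset]
    intro z hz
    have hz' : z.re < 0 := hst z (by
      rw [Multiset.mem_toFinset, Polynomial.mem_roots h0] at hz; exact hz)
    have hpos : 0 < -2 * z.re / (Complex.normSq z + 1) := by
      have := Complex.normSq_nonneg z
      apply div_pos <;> linarith
    filter_upwards [Ioo_mem_nhdsGT hpos] with η hη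
    have h1 : η * (Complex.normSq z + 1) < -2 * z.re := by
      have := hη.2
      rwa [lt_div_iff₀ (by have := Complex.normSq_nonneg z; linarith)] at this
    have h2 : Complex.normSq (1 + (η : ℂ) * z) < 1 := by
      rw [Complex.normSq_apply] at h1 ⊢
      simp only [Complex.add_re, Complex.one_re, Complex.mul_re, Complex.ofReal_re,
        Complex.ofReal_im, Complex.add_im, Complex.one_im, Complex.mul_im]
      have := hη.1
      nlinarith
    rw [Complex.normSq_eq_norm_sq] at h2
    nlinarith [norm_nonneg (1 + (η : ℂ) * z)]
  obtain ⟨η, hη, hηpos⟩ := (hev.and self_mem_nhdsWithin).exists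
  have hηpos : 0 < η := hηpos
  set M : Matrix (Fin q) (Fin q) ℂ := 1 + (η : ℂ) • Jc with hM
  have hMmap : ∀ n : ℕ, M ^ n = ((1 + η • J) ^ n).map Complex.ofReal := by
    intro n
    have : M = (Complex.ofRealHom.mapMatrix) (1 + η • J) := by
      rw [map_add, map_one]
      ext i j
      simp [hM, hJc, Matrix.one_apply]
    rw [this, ← map_pow]
    rfl
  have hspec : ∀ w ∈ spectrum ℂ M, ‖w‖₊ < 1 := by
    intro w hw
    have hηc : (η : ℂ) ≠ 0 := by exact_mod_cast hηpos.ne'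
    have hz : (w - 1) / η ∈ spectrum ℂ Jc := by
      by_contra hcon
      rw [spectrum.notMem_iff] at hcon
      apply hw
      have : algebraMap ℂ (Matrix (Fin q) (Fin q) ℂ) w - M
          = (Units.mk0 (η : ℂ) hηc) • (algebraMap ℂ (Matrix (Fin q) (Fin q) ℂ) ((w - 1) / η) - Jc) := by
        ext i j
        by_cases hij : i = j
        · subst hij
          simp [hM, Units.smul_def, Matrix.algebraMap_matrix_apply]
          field_simp
          ring
        · simp [hM, Units.smul_def, Matrix.algebraMap_matrix_apply, hij]
      rw [spectrum.mem_resolventSet_iff, this]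
      exact hcon.smul _
    rw [Matrix.mem_spectrum_iff_isRoot_charpoly] at hz
    have := hη ((w - 1) / η) (by rw [Multiset.mem_toFinset, Polynomial.mem_roots h0]; exact hz)
    rw [mul_div_cancel₀ _ hηc, add_sub_cancel] at this
    exact_mod_cast this
  have hrad : spectralRadius ℂ M < 1 := by
    have := spectrum.spectralRadius_lt_of_forall_lt M (r := 1) hspec
    simpa using this
  have hT := spectrum.pow_nnnorm_pow_one_div_tendsto_nhds_spectralRadius M
  obtain ⟨n, hn, hn1⟩ := ((hT.eventually_lt_const hrad).and (Filter.eventually_ge_atTop 1)).exists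
  have hn0 : (0 : ℝ) < n := by exact_mod_cast hn1
  have hlt : ‖M ^ n‖₊ < 1 := by
    by_contra hcon
    push Not at hcon
    have : (1 : ℝ≥0∞) ≤ (‖M ^ n‖₊ : ℝ≥0∞) ^ (1 / n : ℝ) :=
      ENNReal.one_le_rpow (by exact_mod_cast hcon) (by positivity)
    exact absurd hn (not_lt.2 this)
  have hlt' : ‖M ^ n‖ < 1 := by exact_mod_cast hlt
  let t : ℝ := max (1/2) ‖M ^ n‖
  have ht0 : 0 < t := lt_of_lt_of_le (by norm_num) (le_max_left _ _)
  have ht1 : t < 1 := max_lt (by norm_num) hlt'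
  refine ⟨η, hηpos, n, hn1, t ^ (1 / n : ℝ), by positivity,
    Real.rpow_lt_one ht0.le ht1 (by positivity), fun i => ?_⟩
  have : (t ^ (1 / n : ℝ)) ^ n = t := by
    rw [← Real.rpow_natCast, ← Real.rpow_mul ht0.le, one_div, inv_mul_cancel₀ hn0.ne',
      Real.rpow_one]
  rw [this]
  refine le_trans ?_ (le_max_right _ _)
  rw [Matrix.linfty_opNorm_def, hMmap]
  have h2 := Finset.le_sup (f := fun i => ∑ j, ‖(((1 + η • J) ^ n).map Complex.ofReal) i j‖₊)
    (Finset.mem_univ i)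
  have h3 : ((∑ j, ‖(((1 + η • J) ^ n).map Complex.ofReal) i j‖₊ : ℝ≥0) : ℝ)
      = ∑ k, |((1 + η • J) ^ n) i k| := by
    push_cast
    refine Finset.sum_congr rfl fun k _ => ?_
    simp
  rw [← h3]
  exact_mod_cast h2

lemma exists_forms (M : Matrix (Fin q) (Fin q) ℝ) (n : ℕ) (hn : 0 < n) (r : ℝ) (hr : 0 < r)
    (hM : ∀ i, ∑ k, |(M ^ n) i k| ≤ r ^ n) :
    ∃ l : Fin q × Fin n → (Fin q → ℝ) →L[ℝ] ℝ,
      (∀ i x, l (i, ⟨0, hn⟩) x = x i) ∧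
      ∀ a, ∃ t : Fin q × Fin n → ℝ, ∑ b, |t b| ≤ r ∧
        ∀ x, l a (M.mulVec x) = ∑ b, t b * l b x := by
  let l : Fin q × Fin n → (Fin q → ℝ) →L[ℝ] ℝ := fun a =>
    (((r ^ (a.2 : ℕ))⁻¹) • ((LinearMap.proj a.1).comp (M ^ (a.2 : ℕ)).mulVecLin)
      : (Fin q → ℝ) →ₗ[ℝ] ℝ).toContinuousLinearMap
  have hl : ∀ a x, l a x = (r ^ (a.2 : ℕ))⁻¹ * ((M ^ (a.2 : ℕ)).mulVec x) a.1 := by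
    intro a x; simp [l]
  refine ⟨l, fun i x => by simp [hl], ?_⟩
  rintro ⟨i, j⟩
  by_cases hj : (j : ℕ) + 1 < n
  · refine ⟨Pi.single (i, ⟨j + 1, hj⟩) r, ?_, fun x => ?_⟩
    · rw [Finset.sum_eq_single (i, ⟨j + 1, hj⟩)]
      · simp [abs_of_pos hr]
      · intro b _ hb; simp [hb]
      · simp
    · rw [Finset.sum_eq_single (i, ⟨j + 1, hj⟩)]
      · simp only [hl, Pi.single_eq_same, Matrix.mulVec_mulVec, pow_succ]
        field_simp
      · intro b _ hb; simp [hb]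
      · simp
  · have hjn : (j : ℕ) + 1 = n := by have := j.2; omega
    refine ⟨fun b => if b.2 = ⟨0, hn⟩ then r * (r ^ n)⁻¹ * (M ^ n) i b.1 else 0, ?_, fun x => ?_⟩
    · rw [Fintype.sum_prod_type]
      have : ∀ k : Fin q, ∑ m : Fin n, |if m = ⟨0, hn⟩ then r * (r ^ n)⁻¹ * (M ^ n) i k else 0|
          = r * (r ^ n)⁻¹ * |(M ^ n) i k| := by
        intro k
        rw [Finset.sum_eq_single ⟨0, hn⟩]
        · rw [if_pos rfl, abs_mul, abs_of_pos (by positivity)]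
        · intro m _ hm; rw [if_neg hm, abs_zero]
        · simp
      simp only [this, ← Finset.mul_sum]
      calc r * (r ^ n)⁻¹ * ∑ k, |(M ^ n) i k| ≤ r * (r ^ n)⁻¹ * r ^ n := by
            gcongr; exact hM i
        _ = r := by field_simp
    · rw [Fintype.sum_prod_type]
      have : ∀ k : Fin q, ∑ m : Fin n,
          (if m = ⟨0, hn⟩ then r * (r ^ n)⁻¹ * (M ^ n) i k else 0) * l (k, m) x
          = r * (r ^ n)⁻¹ * ((M ^ n) i k * x k) := by
        intro k
        rw [Finset.sum_eq_single ⟨0, hn⟩]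
        · rw [if_pos rfl, hl]; simp; ring
        · intro m _ hm; rw [if_neg hm, zero_mul]
        · simp
      simp only [this, ← Finset.mul_sum]
      rw [hl]
      simp only [Matrix.mulVec_mulVec, ← pow_succ, hjn]
      change _ = _ * ((M ^ n).mulVec x) i
      congr 1
      have hrn : r ^ n = r ^ (j : ℕ) * r := by rw [← pow_succ, hjn]
      rw [hrn]
      field_simp

end linalg
end DR
namespace DR
open scoped ENNReal NNReal Topology
section final
variable {q : ℕ}

lemma lin_coeff {ι : Type*} [Fintype ι] [DecidableEq ι] (t : ι → ℝ) :
    ∃ c : (ι → ℕ) → ℝ, (Summable fun α => ‖c α‖) ∧ ∑' α, ‖c α‖ ≤ ∑ b, |t b| ∧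
      ∀ y : ι → ℝ, HasSum (fun α => mon y α * c α) (∑ b, t b * y b) := by
  let c1 : ι → (ι → ℕ) → ℝ := fun b α => if α = Pi.single b 1 then t b else 0
  have h1 : ∀ b, HasSum (fun α => ‖c1 b α‖) |t b| := by
    intro b
    have := hasSum_ite_eq (Pi.single b 1 : ι → ℕ) |t b|
    convert this using 2 with α
    by_cases h : α = Pi.single b 1 <;> simp [c1, h]
  have hs : HasSum (fun α => ∑ b, ‖c1 b α‖) (∑ b, |t b|) := hasSum_sum fun b _ => h1 b
  have hle : ∀ α, ‖∑ b, c1 b α‖ ≤ ∑ b, ‖c1 b α‖ := fun α => norm_sum_le _ _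
  have hsm : Summable fun α => ‖∑ b, c1 b α‖ :=
    Summable.of_nonneg_of_le (fun _ => norm_nonneg _) hle hs.summable
  refine ⟨fun α => ∑ b, c1 b α, hsm, ?_, ?_⟩
  · rw [← hs.tsum_eq]
    exact hsm.tsum_le_tsum hle hs.summable
  · intro y
    simp only [Finset.mul_sum]
    refine hasSum_sum fun b _ => ?_
    have hm : mon y (Pi.single b 1) = y b := by
      unfold mon
      rw [Finset.prod_eq_single b]
      · simp
      · intro a _ ha; simp [Pi.single_eq_of_ne ha]
      · simp
    have h := hasSum_single (f := fun α => mon y α * c1 b α) (Pi.single b 1 : ι → ℕ) (by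
      intro α hα; simp [c1, hα])
    simpa [c1, hm, mul_comm] using h

lemma ps_zero1 {F : Type*} [NormedAddCommGroup F] [NormedSpace ℝ F]
    (f : (Fin q → ℝ) → F) (hf : AnalyticAt ℝ f 0) (h0 : f 0 = 0) :
    ∃ p : FormalMultilinearSeries ℝ (Fin q → ℝ) F, HasFPowerSeriesAt f p 0 ∧ ∀ i < 1, p i = 0 := by
  obtain ⟨p, hp⟩ := hf
  refine ⟨p, hp, fun i hi => ?_⟩
  obtain rfl : i = 0 := by omega
  ext v
  rw [hp.coeff_zero v, h0]; rfl

lemma ps_zero2 {F : Type*} [NormedAddCommGroup F] [NormedSpace ℝ F]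
    (f : (Fin q → ℝ) → F) (hf : AnalyticAt ℝ f 0) (h0 : f 0 = 0)
    (h1 : HasFDerivAt f (0 : (Fin q → ℝ) →L[ℝ] F) 0) :
    ∃ p : FormalMultilinearSeries ℝ (Fin q → ℝ) F, HasFPowerSeriesAt f p 0 ∧ ∀ i < 2, p i = 0 := by
  obtain ⟨p, hp⟩ := hf
  refine ⟨p, hp, fun i hi => ?_⟩
  have h2 := hp.hasFDerivAt.unique h1
  interval_cases i
  · ext v
    rw [hp.coeff_zero v, h0]; rfl
  · exact (continuousMultilinearCurryFin1 ℝ (Fin q → ℝ) F).map_eq_zero_iff.mp h2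

theorem main_aux (At : (Fin q → ℝ) → Matrix (Fin q) (Fin q) ℝ)
    (hAt : ∀ i j, AnalyticAt ℝ (fun x => At x i j) 0)
    (hoff : ∀ i j, i ≠ j → 0 ≤ At 0 i j) (hrow : ∀ i, ∑ j, At 0 i j = 0)
    (θ : (Fin q → ℝ) → (Fin q → ℝ)) (hθ : AnalyticAt ℝ θ 0) (hθ0 : θ 0 = 0)
    (J : Matrix (Fin q) (Fin q) ℝ) (hJ : HasFDerivAt θ J.mulVecLin.toContinuousLinearMap 0)
    (hst : ∀ z : ℂ, (Matrix.charpoly (J.map Complex.ofReal)).IsRoot z → z.re < 0) :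
    ∃ V : Set (Fin q → ℝ), IsOpen V ∧ 0 ∈ V ∧ ∃ u : (Fin q → ℝ) → (Fin q → ℝ),
      AnalyticOnNhd ℝ u V ∧ u 0 = 0 ∧
      ∀ x ∈ V, (At x).mulVec ((fun _ => 1) + u x) + fderiv ℝ u x (θ x) = 0 := by
  obtain ⟨η, hη, n, hn, r, hr, hr1, hM⟩ := exists_contr J hst
  obtain ⟨l0, hl0, ht⟩ := exists_forms (1 + η • J) n hn r hr hM
  choose t htr htM using ht
  let κ : Fin q → Fin q × Fin n := fun i => (i, ⟨0, hn⟩)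
  let N : (Fin q → ℝ) → (Fin q → ℝ) := fun x => θ x - J.mulVecLin.toContinuousLinearMap x
  have hN : AnalyticAt ℝ N 0 := hθ.sub (ContinuousLinearMap.analyticAt _ _)
  have hN0 : N 0 = 0 := by simp [N, hθ0]
  have hN1 : HasFDerivAt N (0 : (Fin q → ℝ) →L[ℝ] (Fin q → ℝ)) 0 := by
    have := hJ.sub (J.mulVecLin.toContinuousLinearMap.hasFDerivAt (x := 0))
    rwa [sub_self] at this
  have hex : ∀ a, ∃ C R0 : ℝ, 0 ≤ C ∧ 0 < R0 ∧ ∀ ρ, 0 < ρ → ρ ≤ R0 →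
      ∃ c : (Fin q × Fin n → ℕ) → ℝ, (Summable fun α => ‖c α‖) ∧ ∑' α, ‖c α‖ ≤ C * ρ ^ 2 ∧
      ∀ y : Fin q × Fin n → ℝ, (∀ a, |y a| ≤ 1) →
        HasSum (fun α => mon y α • c α) (l0 a (N (fun i => ρ * y (κ i)))) := by
    intro a
    obtain ⟨p, hp, hp0⟩ := ps_zero2 (fun x => l0 a (N x))
      (((l0 a).analyticAt _).comp hN) (by simp [hN0])
      (by
        have h := (l0 a).hasFDerivAt.comp (0 : Fin q → ℝ) hN1
        rw [ContinuousLinearMap.comp_zero] at h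
        exact h)
    exact expand κ _ p hp 2 hp0
  choose C R0 hC hR0 hexp using hex
  let Bb : Fin q → Fin q → (Fin q → ℝ) →L[ℝ] (Fin q → ℝ) := fun i j =>
    (ContinuousLinearMap.proj (R := ℝ) (φ := fun _ : Fin q => ℝ) j).smulRight (Pi.single i (1:ℝ) : Fin q → ℝ)
  let B : (Fin q → ℝ) → (Fin q → ℝ) →L[ℝ] (Fin q → ℝ) := fun x =>
    ∑ i, ∑ j, (At x i j - At 0 i j) • Bb i j
  have hBan : AnalyticAt ℝ B 0 := by
    refine Finset.analyticAt_fun_sum _ fun i _ => Finset.analyticAt_fun_sum _ fun j _ => ?_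
    exact ((hAt i j).sub analyticAt_const).smul analyticAt_const
  have hB0 : B 0 = 0 := by simp [B]
  have hBapp : ∀ x f, B x f = (At x).mulVec f - (At 0).mulVec f := by
    intro x f
    ext k
    simp only [B, Bb, Matrix.mulVec, dotProduct, _root_.sum_apply,
      _root_.smul_apply, ContinuousLinearMap.smulRight_apply, Finset.sum_apply,
      Pi.smul_apply, Pi.sub_apply, ContinuousLinearMap.proj_apply, smul_eq_mul]
    rw [Finset.sum_eq_single k]
    · rw [← Finset.sum_sub_distrib]
      refine Finset.sum_congr rfl fun j _ => ?_
      simp; ring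
    · intro i _ hi
      refine Finset.sum_eq_zero fun j _ => ?_
      simp [Pi.single_eq_of_ne (Ne.symm hi)]
    · simp
  obtain ⟨pB, hpB, hpB0⟩ := ps_zero1 B hBan hB0
  obtain ⟨CB, RB, hCB, hRB, hexpB⟩ := expand κ B pB hpB 1 hpB0
  -- choice of the scale
  have hev : ∀ᶠ ρ : ℝ in 𝓝[>] 0, 0 < ρ ∧ ρ ≤ RB ∧ (∀ a, ρ ≤ R0 a) ∧
      η * ((η⁻¹ * r + (∑ a, C a) * ρ) + CB * ρ) < 1 := by
    have hA : ∀ R : ℝ, 0 < R → ∀ᶠ ρ : ℝ in 𝓝[>] 0, ρ ≤ R := fun R hR =>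
      nhdsWithin_le_nhds (Iic_mem_nhds hR)
    have hpos : ∀ᶠ ρ : ℝ in 𝓝[>] 0, 0 < ρ := self_mem_nhdsWithin
    refine hpos.and ((hA _ hRB).and
      (Filter.Eventually.and (Filter.eventually_all.mpr fun a => hA _ (hR0 a)) ?_))
    have hc : Continuous fun ρ : ℝ => η * ((η⁻¹ * r + (∑ a, C a) * ρ) + CB * ρ) := by fun_prop
    have := hc.tendsto 0
    have h2 : η * ((η⁻¹ * r + (∑ a, C a) * 0) + CB * 0) < 1 := by
      have : η * ((η⁻¹ * r + (∑ a, C a) * 0) + CB * 0) = r := by field_simp; ring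
      rw [this]; exact hr1
    exact nhdsWithin_le_nhds (this.eventually_lt_const h2)
  obtain ⟨ρ, hρ, hρB, hρR, hsmall⟩ := hev.exists
  choose c hcs hcn hcH using fun a => hexp a ρ hρ (hρR a)
  obtain ⟨b, hbs, hbn, hbH⟩ := hexpB ρ hρ hρB
  choose d hds hdn hdH using fun a => lin_coeff (t a)
  let l : Fin q × Fin n → (Fin q → ℝ) →L[ℝ] ℝ := fun a => ρ⁻¹ • l0 a
  have hl : ∀ a x, l a x = ρ⁻¹ * l0 a x := fun a x => rfl
  have hx : ∀ x : Fin q → ℝ, (fun i => ρ * l (κ i) x) = x := by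
    intro x; ext i
    rw [hl, hl0]; field_simp
  let W : (Fin q → ℝ) → (Fin q → ℝ) := fun x => η⁻¹ • (1 + η • J).mulVec x + N x
  have hWθ : ∀ x, W x - η⁻¹ • x = θ x := by
    intro x
    have : η⁻¹ • (1 + η • J).mulVec x = η⁻¹ • x + J.mulVec x := by
      rw [Matrix.add_mulVec, Matrix.one_mulVec, Matrix.smul_mulVec, smul_add, smul_smul,
        inv_mul_cancel₀ hη.ne', one_smul]
    simp only [W, this, N]
    simp
  let w : Fin q × Fin n → (Fin q × Fin n → ℕ) → ℝ := fun a α => η⁻¹ * d a α + ρ⁻¹ * c a α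
  have hwb : ∀ a α, ‖w a α‖ ≤ η⁻¹ * ‖d a α‖ + ρ⁻¹ * ‖c a α‖ := by
    intro a α
    refine (norm_add_le _ _).trans (le_of_eq ?_)
    rw [norm_mul, norm_mul, Real.norm_of_nonneg (inv_pos.mpr hη).le,
      Real.norm_of_nonneg (inv_pos.mpr hρ).le]
  have hws' : ∀ a, Summable fun α => η⁻¹ * ‖d a α‖ + ρ⁻¹ * ‖c a α‖ := fun a =>
    ((hds a).mul_left _).add ((hcs a).mul_left _)
  have hws : ∀ a, Summable fun α => ‖w a α‖ := fun a =>
    Summable.of_nonneg_of_le (fun _ => norm_nonneg _) (hwb a) (hws' a)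
  have hwn : ∀ a, ∑' α, ‖w a α‖ ≤ η⁻¹ * r + (∑ a, C a) * ρ := by
    intro a
    refine ((hws a).tsum_le_tsum (hwb a) (hws' a)).trans ?_
    rw [((hds a).mul_left _).tsum_add ((hcs a).mul_left _), tsum_mul_left, tsum_mul_left]
    have h1 : C a ≤ ∑ a, C a := Finset.single_le_sum (fun i _ => hC i) (Finset.mem_univ a)
    have h2 : ρ⁻¹ * ∑' α, ‖c a α‖ ≤ (∑ a, C a) * ρ := by
      calc ρ⁻¹ * ∑' α, ‖c a α‖ ≤ ρ⁻¹ * (C a * ρ ^ 2) := by gcongr; exact hcn a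
        _ = C a * ρ := by field_simp
        _ ≤ _ := by gcongr
    have h3 : η⁻¹ * ∑' α, ‖d a α‖ ≤ η⁻¹ * r := by
      gcongr; exact (hdn a).trans (htr a)
    linarith
  have hωnn : 0 ≤ η⁻¹ * r + (∑ a, C a) * ρ := by
    have := Finset.sum_nonneg (fun i (_ : i ∈ (Finset.univ : Finset (Fin q × Fin n))) => hC i)
    positivity
  have hres : ∀ k : ℕ, ∃ R : (Fin q → ℝ) →L[ℝ] (Fin q → ℝ), 1 ≤ k →
      ∀ f, ((k:ℝ)/η) • R f - (At 0).mulVec (R f) = f ∧ ((k:ℝ)/η) * ‖R f‖ ≤ ‖f‖ := by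
    intro k
    by_cases hk : 1 ≤ k
    · obtain ⟨R, hR⟩ := exists_resolvent (At 0) hoff hrow ((k:ℝ)/η)
        (div_pos (by exact_mod_cast hk) hη)
      exact ⟨R, fun _ => hR⟩
    · exact ⟨0, fun h => absurd h hk⟩
  choose Res hRes using hres
  obtain ⟨u, hu, hu0, hueq⟩ := core_thm l η hη W w (η⁻¹ * r + (∑ a, C a) * ρ) hωnn hws hwn
    (by
      intro x hxl a
      have e1 := (hdH a (fun a => l a x)).mul_left η⁻¹
      have e2 := (hcH a (fun a => l a x) hxl).mul_left ρ⁻¹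
      have e3 := e1.add e2
      simp only [hx x] at e3
      have : l a (W x) = η⁻¹ * ∑ b, t a b * l b x + ρ⁻¹ * l0 a (N x) := by
        simp only [W, map_add, map_smul, smul_eq_mul]
        rw [hl, hl, htM]
        simp only [hl, Finset.mul_sum]
        congr 1
        refine Finset.sum_congr rfl fun b _ => by ring
      rw [this]
      have hfun : (fun α => mon (fun a => l a x) α * w a α) = fun b =>
          η⁻¹ * (mon (fun a => l a x) b * d a b) + ρ⁻¹ * mon (fun a => l a x) b • c a b := by
        funext α
        simp only [w, smul_eq_mul]
        ring
      rw [hfun]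
      exact e3)
    B b (CB * ρ) hbs (by simpa using hbn)
    (by
      intro x hxl
      have := hbH (fun a => l a x) hxl
      simpa only [hx x] using this)
    (by simp [W, hN0]) hB0 (At 0).mulVecLin.toContinuousLinearMap (fun _ => 1)
    (by
      ext i
      simpa [Matrix.mulVec, dotProduct] using hrow i)
    Res (fun k hk f => by simpa using (hRes k hk f).1) (fun k hk f => (hRes k hk f).2) hsmall
  refine ⟨{x | ∀ a, |l a x| < 1}, ?_, by simp, u, hu, hu0, ?_⟩
  · simp only [Set.ofPred_forall]
    exact isOpen_iInter_of_finite fun a => isOpen_lt (by fun_prop) continuous_const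
  · intro x hxV
    have := hueq x hxV
    rw [hWθ] at this
    rw [_root_.add_apply, hBapp] at this
    simpa using this

end final
end DR
/-- Under the density-regulation assumptions (fixed point `h_eq`,
stable Jacobian `Jθ(h_eq)`, irreducible `A(h_eq)`, analyticity at `h_eq`), there is
an open neighborhood `V` of `h_eq` inside the positive orthant and a real-analytic
`Λ : V → ℝ^q` with `Λ(h_eq) = v_eq` and `A(h)ᵀ Λ(h) + [JΛ(h)] θ(h) = 0` on `V`. -/
theorem stmt_10 (q : ℕ) (hq : 1 ≤ q)
    (β : Fin q → Fin q → (Fin q → ℝ) → ℝ) (ρ : Fin q → (Fin q → ℝ) → ℝ)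
    (U : Set (Fin q → ℝ)) (hU : IsOpen U)
    (hUorth : {h : Fin q → ℝ | ∀ i, 0 ≤ h i} ⊆ U)
    (hβC : ∀ i j, ContDiffOn ℝ 2 (β i j) U)
    (hρC : ∀ i, ContDiffOn ℝ 2 (ρ i) U)
    (hβnn : ∀ i j, ∀ h : Fin q → ℝ, (∀ k, 0 ≤ h k) → 0 ≤ β i j h)
    (hρnn : ∀ i, ∀ h : Fin q → ℝ, (∀ k, 0 ≤ h k) → 0 ≤ ρ i h)
    (hβbdd : ∀ i j, BddAbove (β i j '' {h : Fin q → ℝ | ∀ k, 0 ≤ h k}))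
    (heq : Fin q → ℝ) (heqnn : ∀ i, 0 ≤ heq i) (heqne : heq ≠ 0)
    (heqfix : densityField q β ρ heq = 0)
    (hstable : ∀ z : ℂ,
      (Matrix.charpoly ((Matrix.of fun i j : Fin q =>
        fderiv ℝ (fun x => densityField q β ρ x i) heq (Pi.single j 1)).map
          Complex.ofReal)).IsRoot z → z.re < 0)
    (hIrred : ∀ S : Set (Fin q), S.Nonempty → S ≠ Set.univ →
      ∃ i ∈ S, ∃ j, j ∉ S ∧ interactionMatrix q β ρ heq i j ≠ 0)
    (hβan : ∀ i j, AnalyticAt ℝ (β i j) heq)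
    (hρan : ∀ i, AnalyticAt ℝ (ρ i) heq)
    (veq : Fin q → ℝ) (hveqpos : ∀ i, 0 < veq i)
    (hveqnull : Matrix.vecMul veq (interactionMatrix q β ρ heq) = 0)
    (hveqinner : ∑ i, veq i * heq i = 1) :
    ∃ V : Set (Fin q → ℝ), IsOpen V ∧ heq ∈ V ∧
      V ⊆ {h : Fin q → ℝ | ∀ i, 0 < h i} ∧
      ∃ Λ : (Fin q → ℝ) → (Fin q → ℝ),
        AnalyticOnNhd ℝ Λ V ∧ Λ heq = veq ∧
        ∀ h ∈ V,
          (interactionMatrix q β ρ h).transpose.mulVec (Λ h)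
            + fderiv ℝ Λ h (densityField q β ρ h) = 0 := by
  classical
  set A := interactionMatrix q β ρ with hA
  have hAoff : ∀ i j, i ≠ j → 0 ≤ A heq i j := by
    intro i j hij
    simp only [hA, interactionMatrix, Matrix.of_apply, if_neg hij]
    exact hβnn _ _ _ heqnn
  have hfix : ∀ i, ∑ j, A heq i j * heq j = 0 := fun i => congrFun heqfix i
  -- positivity of the equilibrium
  have heqpos : ∀ i, 0 < heq i := by
    by_contra hcon
    push Not at hcon
    obtain ⟨i0, hi0⟩ := hcon
    have hS1 : ({i | heq i = 0} : Set (Fin q)).Nonempty := ⟨i0, le_antisymm hi0 (heqnn i0)⟩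
    have hS2 : ({i | heq i = 0} : Set (Fin q)) ≠ Set.univ := by
      intro h
      apply heqne
      funext i
      have : i ∈ ({i | heq i = 0} : Set (Fin q)) := by rw [h]; trivial
      exact this
    obtain ⟨i, hi, j, hj, hne⟩ := hIrred _ hS1 hS2
    have hi' : heq i = 0 := hi
    have hj' : heq j ≠ 0 := hj
    have hterm : ∀ k ∈ (Finset.univ : Finset (Fin q)), 0 ≤ A heq i k * heq k := by
      intro k _
      by_cases hk : i = k
      · rw [← hk, hi', mul_zero]
      · exact mul_nonneg (hAoff i k hk) (heqnn k)
    have h0 := (Finset.sum_eq_zero_iff_of_nonneg hterm).mp (hfix i) j (Finset.mem_univ j)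
    rcases mul_eq_zero.mp h0 with h | h
    · exact hne h
    · exact hj' h
  -- analyticity
  have hAan : ∀ i j, AnalyticAt ℝ (fun h => A h i j) heq := by
    intro i j
    by_cases hij : i = j
    · have : (fun h => A h i j) = fun h => β i i h - ρ i h := by
        funext h; simp [hA, interactionMatrix, hij]
      rw [this]; exact (hβan i i).sub (hρan i)
    · have : (fun h => A h i j) = β j i := by
        funext h; simp [hA, interactionMatrix, hij]
      rw [this]; exact hβan j i
  have hDan : AnalyticAt ℝ (densityField q β ρ) heq := by
    refine AnalyticAt.pi fun i => ?_
    have : (fun h => densityField q β ρ h i) = fun h => ∑ j, A h i j * h j := rfl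
    rw [this]
    refine Finset.analyticAt_fun_sum _ fun j _ => (hAan i j).mul ?_
    exact (ContinuousLinearMap.proj (R := ℝ) (φ := fun _ : Fin q => ℝ) j).analyticAt _
  have hsh : AnalyticAt ℝ (fun x : Fin q → ℝ => heq + x) 0 := analyticAt_const.add analyticAt_id
  have hsh0 : heq + (0 : Fin q → ℝ) = heq := add_zero _
  set J : Matrix (Fin q) (Fin q) ℝ := Matrix.of fun i j : Fin q =>
        fderiv ℝ (fun x => densityField q β ρ x i) heq (Pi.single j 1) with hJdef
  have hJ : HasFDerivAt (densityField q β ρ) J.mulVecLin.toContinuousLinearMap heq := by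
    have hd := hDan.differentiableAt.hasFDerivAt
    have hEq : fderiv ℝ (densityField q β ρ) heq = J.mulVecLin.toContinuousLinearMap := by
      ext v i
      have hc : HasFDerivAt (fun x => densityField q β ρ x i) _ heq := (hasFDerivAt_pi'.mp hd) i
      have h1 : ∀ v, fderiv ℝ (fun x => densityField q β ρ x i) heq v
          = fderiv ℝ (densityField q β ρ) heq v i := by
        intro v; rw [hc.fderiv]; rfl
      rw [← h1]
      have h2 := LinearMap.pi_apply_eq_sum_univ
        (fderiv ℝ (fun x => densityField q β ρ x i) heq : (Fin q → ℝ) →ₗ[ℝ] ℝ) v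
      simp only [ContinuousLinearMap.coe_coe, smul_eq_mul] at h2
      rw [h2]
      simp only [LinearMap.coe_toContinuousLinearMap', Matrix.mulVecLin_apply, Matrix.mulVec,
        dotProduct, hJdef, Matrix.of_apply]
      refine Finset.sum_congr rfl fun j _ => ?_
      rw [mul_comm]
      congr 2
      funext k
      simp [Pi.single_apply, eq_comm]
    rwa [hEq] at hd
  have hcol : ∀ i, ∑ j, veq j * A heq j i = 0 := fun i => congrFun hveqnull i
  obtain ⟨V, hVo, hV0, u, hu, hu0, hueq⟩ := DR.main_aux
    (fun x => Matrix.of fun i j => A (heq + x) j i * veq j / veq i)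
    (by
      intro i j
      have h1 : AnalyticAt ℝ (fun x => A (heq + x) j i) 0 :=
        AnalyticAt.fun_comp (g := fun h => A h j i) (by rw [hsh0]; exact hAan j i) hsh
      have h2 := (h1.mul (analyticAt_const (v := veq j))).mul (analyticAt_const (v := (veq i)⁻¹))
      simp only [Matrix.of_apply, div_eq_mul_inv]
      exact h2)
    (by
      intro i j hij
      simp only [Matrix.of_apply, hsh0]
      exact div_nonneg (mul_nonneg (hAoff j i (Ne.symm hij)) (hveqpos j).le) (hveqpos i).le)
    (by
      intro i
      simp only [Matrix.of_apply, hsh0]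
      rw [← Finset.sum_div]
      have : ∑ j, A heq j i * veq j = 0 := by
        rw [← hcol i]; exact Finset.sum_congr rfl fun j _ => mul_comm _ _
      rw [this, zero_div])
    (fun x => densityField q β ρ (heq + x))
    (AnalyticAt.fun_comp (by rw [hsh0]; exact hDan) hsh)
    (by simpa only [hsh0] using heqfix) J
    (by
      have h1 : HasFDerivAt (fun x : Fin q → ℝ => heq + x)
        (ContinuousLinearMap.id ℝ (Fin q → ℝ)) 0 := (hasFDerivAt_id 0).const_add heq
      have h2 : HasFDerivAt (densityField q β ρ) J.mulVecLin.toContinuousLinearMap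
        (heq + 0) := by rw [hsh0]; exact hJ
      have h3 := h2.comp (0 : Fin q → ℝ) h1
      rw [ContinuousLinearMap.comp_id] at h3
      exact h3)
    hstable
  have hsub : Continuous fun h : Fin q → ℝ => h - heq := continuous_id.sub continuous_const
  let L : (Fin q → ℝ) →L[ℝ] (Fin q → ℝ) := ContinuousLinearMap.pi fun i =>
    veq i • ContinuousLinearMap.proj (R := ℝ) (φ := fun _ : Fin q => ℝ) i
  have hL : ∀ f i, L f i = veq i * f i := fun f i => rfl
  refine ⟨(fun h => h - heq) ⁻¹' V ∩ {h | ∀ i, 0 < h i}, ?_, ⟨?_, heqpos⟩, fun h hh => hh.2,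
    fun h => L ((fun _ => 1) + u (h - heq)), ?_, ?_, ?_⟩
  · refine (hVo.preimage hsub).inter ?_
    simp only [Set.ofPred_forall]
    exact isOpen_iInter_of_finite fun a => isOpen_lt continuous_const (continuous_apply a)
  · simpa using hV0
  · intro h hh
    have h1 : AnalyticAt ℝ (fun h : Fin q → ℝ => h - heq) h := analyticAt_id.sub analyticAt_const
    have h2 : AnalyticAt ℝ (fun h => u (h - heq)) h := AnalyticAt.fun_comp (hu _ hh.1) h1
    exact AnalyticAt.fun_comp (L.analyticAt _) (analyticAt_const.add h2)
  · funext i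
    simp [hL, hu0]
  · intro h hh
    have hd : HasFDerivAt u (fderiv ℝ u (h - heq)) (h - heq) :=
      (hu _ hh.1).differentiableAt.hasFDerivAt
    have h1 : HasFDerivAt (fun h : Fin q → ℝ => h - heq)
        (ContinuousLinearMap.id ℝ (Fin q → ℝ)) h := (hasFDerivAt_id h).sub_const heq
    have h2 := hd.comp h h1
    rw [ContinuousLinearMap.comp_id] at h2
    have h3 := L.hasFDerivAt.comp h (h2.const_add (fun _ => (1:ℝ)))
    have h4 : fderiv ℝ (fun h => L ((fun _ => 1) + u (h - heq))) h
        = L.comp (fderiv ℝ u (h - heq)) := h3.fderiv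
    rw [h4]
    have h5 := hueq (h - heq) hh.1
    have h6 : heq + (h - heq) = h := by abel
    simp only [h6] at h5
    funext i
    have h7 := congrFun h5 i
    simp only [Pi.add_apply, Pi.zero_apply, Matrix.mulVec, dotProduct, Matrix.of_apply] at h7
    simp only [Pi.add_apply, Pi.zero_apply, Matrix.mulVec, dotProduct, Matrix.transpose_apply,
      ContinuousLinearMap.comp_apply, hL]
    have h8 := congrArg (fun z => veq i * z) h7
    simp only [mul_add, mul_zero, Finset.mul_sum] at h8
    rw [← h8]
    simp only [mul_add]
    congr 1
    refine Finset.sum_congr rfl fun j _ => ?_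
    have := (hveqpos i).ne'
    field_simp
end
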